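/- Theorem 3.1, identity (3.2) (Shuffling Theorem for Halved Hexagons, F̄-type): Let x,y,u,d,u',d',n be nonnegative integers with u,d,u',d' ≤ n, and let U={s_1<...<s_u}, D={t_1<...<t_d}, U'={s'_1<...<s'_{u'}}, D'={t'_1<...<t'_{d'}} be subsets of [x+y+n] such that U∪D = U'∪D' and U∩D = U'∩D'. Let B ⊆ [x+y+n]\(U∪D) with |B| ≤ x. Then M(F̄_{x,y}(U;D;B)) / M(F̄_{x,y}(U';D';B)) = [∏_{1≤i<j≤u} (s_j−s_i)(s_j+s_i−1)] / [∏_{1≤i<j≤u'} (s'_j−s'_i)(s'_j+s'_i−1)] · [∏_{1≤i<j≤d} (t_j−t_i)(t_j+t_i−1)] / [∏_{1≤i<j≤d'} (t'_j−t'_i)(t'_j+t'_i−1)] · [H2(2u'+2y)·H2(2d'+2y)] / [H2(2u+2y)·H2(2d+2y)]. -/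

import Mathlib

open Finset

/-- A unit triangle of the triangular lattice, in sheared coordinates:
`(true, a, j)` is the up-pointing triangle with horizontal base
`[a + j/2, a + 1 + j/2]` on the lattice line at height `j`;
`(false, a, j)` is the down-pointing triangle with apex `(a + 1 + j/2, j)`
and top edge on the lattice line at height `j + 1`. -/
abbrev Tri : Type := Bool × ℤ × ℤ

def upT (a j : ℤ) : Tri := (true, a, j)
def dnT (a j : ℤ) : Tri := (false, a, j)

/-- A lozenge (union of two unit triangles sharing an edge), recorded by the
coordinates of its up-pointing triangle (first component) and of its
down-pointing triangle (second component). -/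
abbrev Loz : Type := (ℤ × ℤ) × (ℤ × ℤ)

/-- The two triangles of a lozenge share an edge: the down-pointing triangle is
the right, left or lower neighbour of the up-pointing one. -/
def lozAdj (l : Loz) : Prop :=
  l.2 = l.1 ∨ l.2 = (l.1.1 - 1, l.1.2) ∨ l.2 = (l.1.1, l.1.2 - 1)

/-- `T` is a lozenge tiling of the region `R`: it consists of lozenges lying in
`R` and covers every unit triangle of `R` exactly once. -/
def IsTiling (R : Finset Tri) (T : Finset Loz) : Prop :=
  (∀ l ∈ T, lozAdj l ∧ upT l.1.1 l.1.2 ∈ R ∧ dnT l.2.1 l.2.2 ∈ R) ∧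
  (∀ t ∈ R, ∃! l, l ∈ T ∧ (t = upT l.1.1 l.1.2 ∨ t = dnT l.2.1 l.2.2))

/-- All lozenge tilings of `R` avoiding the forbidden lozenges in `F`
(the barriers), collected in a finset. -/
noncomputable def tilings (R : Finset Tri) (F : Finset Loz) : Finset (Finset Loz) := by
  classical
  exact ((R.image Prod.snd ×ˢ R.image Prod.snd).powerset).filter
    (fun T => IsTiling R T ∧ ∀ l ∈ T, l ∉ F)

/-- `Mtil R F` : the number of lozenge tilings of `R` avoiding the barriers `F`. -/
noncomputable def Mtil (R : Finset Tri) (F : Finset Loz) : ℕ := (tilings R F).card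

/-- Weighted tiling number: each lozenge in `Wt` carries weight `1/2`, all other
lozenges weight `1`; a tiling is weighted by the product of its lozenge weights. -/
noncomputable def Mw (R : Finset Tri) (F : Finset Loz) (Wt : Finset Loz) : ℚ :=
  ∑ T ∈ tilings R F, (1 / 2 : ℚ) ^ (T ∩ Wt).card

/-- Reflection of a unit triangle over the horizontal lattice line `l` (height `0`). -/
def reflTri (t : Tri) : Tri :=
  if t.1 then (false, t.2.1 + t.2.2, -t.2.2 - 1) else (true, t.2.1 + t.2.2 + 1, -t.2.2 - 1)

/-- Reflection of a lozenge over the horizontal lattice line `l` (height `0`). -/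
def reflLoz (l : Loz) : Loz :=
  ((l.2.1 + l.2.2 + 1, -l.2.2 - 1), (l.1.1 + l.1.2, -l.1.2 - 1))

/-- The up-pointing unit triangles removed at the positions of `U`
(1-indexed, from left to right) just above the line `l`. -/
def upDents (U : Finset ℕ) : Finset Tri := U.image (fun (i : ℕ) => upT ((i : ℤ) - 1) 0)

/-- The down-pointing unit triangles removed at the positions of `D`
(1-indexed, from left to right) just below the line `l`. -/
def dnDents (D : Finset ℕ) : Finset Tri := D.image (fun (i : ℕ) => dnT ((i : ℤ) - 1) (-1))

/-- The vertical lozenges straddling the line `l` at the barrier positions `B`: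
these are forbidden in any tiling. -/
def barrierLoz (B : Finset ℕ) : Finset Loz :=
  B.image (fun (i : ℕ) => (((i : ℤ) - 1, 0), ((i : ℤ) - 1, -1)))

/-- The upper half of a hexagon: the semihexagon (trapezoid) with base `W` on the
line `l` and `h` rows of unit triangles above it. -/
def upperHex (W h : ℕ) : Finset Tri :=
  (Finset.range h).biUnion fun j =>
    ((Finset.range (W - j)).image fun (a : ℕ) => upT (a : ℤ) (j : ℤ)) ∪
    ((Finset.range (W - j - 1)).image fun (a : ℕ) => dnT (a : ℤ) (j : ℤ))

/-- The doubly-dented hexagon `H_{x,y}(U; D)` (with `n = |U ∪ D|` recorded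
explicitly): the hexagon of side lengths `x+n-u, y+u, y+d, x+n-d, y+d, y+u`
(clockwise from the north side) with the up-pointing unit triangles at the
positions of `U` and the down-pointing unit triangles at the positions of `D`
removed along the horizontal axis `l` through its west and east vertices. -/
def Hreg (x y n : ℕ) (U D : Finset ℕ) : Finset Tri :=
  (upperHex (x + y + n) (y + U.card) \ upDents U) ∪
  ((upperHex (x + y + n) (y + D.card)).image reflTri \ dnDents D)

/-- The quartered hexagon `L_{m,n}(A)`: the trapezoid whose northern,
northeastern, southern sides have lengths `n`, `m`, `n + ⌊(m+1)/2⌋` and whose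
western side is a vertical zigzag of `m` steps, with the up-pointing unit
triangles at the positions of `A` removed from the base. -/
def Lreg (m n : ℕ) (A : Finset ℕ) : Finset Tri :=
  ((Finset.range m).biUnion fun j =>
    ((Finset.range (n + (m + 1) / 2 + j / 2 - j)).image
        fun (a : ℕ) => upT ((a : ℤ) - ((j / 2 : ℕ) : ℤ)) (j : ℤ)) ∪
    ((Finset.range (n + (m + 1) / 2 + (j + 1) / 2 - (j + 1))).image
        fun (a : ℕ) => dnT ((a : ℤ) - (((j + 1) / 2 : ℕ) : ℤ)) (j : ℤ)))
  \ upDents A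

/-- The vertical lozenges sitting along (the bumps of) the western zigzag side
of the quartered hexagon `L_{m,n}`; these get weight `1/2` in `L̄_{m,n}`. -/
def westLoz (m : ℕ) : Finset Loz :=
  ((Finset.range m).filter fun j => j % 2 = 1).image fun j =>
    ((-(((j - 1) / 2 : ℕ) : ℤ), (j : ℤ)), (-(((j - 1) / 2 : ℕ) : ℤ), (j : ℤ) - 1))

/-- The doubly-dented halved hexagon `F_{x,y}(U; D)`: north, northeast,
southeast, south sides of lengths `x+n-u, 2y+2u, 2y+2d, x+n-d`, western side a
vertical zigzag with `4y+2u+2d` steps, with up-dents `U` and down-dents `D`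
along the horizontal line `l` through the east vertex. -/
def Freg (x y n : ℕ) (U D : Finset ℕ) : Finset Tri :=
  Lreg (2 * y + 2 * U.card) (x + n - U.card) U ∪
  (Lreg (2 * y + 2 * D.card) (x + n - D.card) D).image reflTri

/-- The doubly-dented halved hexagon `F̄_{x,y}(U; D)`: side lengths
`x+n-u, 2y-1+2u, 2y-1+2d, x+n-d` and a western zigzag with `4y+2u+2d-2` steps,
with up-dents `U` and down-dents `D` along the line `l` through the east vertex. -/
def Fbar (x y n : ℕ) (U D : Finset ℕ) : Finset Tri :=
  Lreg (2 * y + 2 * U.card - 1) (x + n - U.card) U ∪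
  (Lreg (2 * y + 2 * D.card - 1) (x + n - D.card) D).image reflTri

/-- The weight-`1/2` vertical lozenges on the western side of `W_{x,y}(U;D;B)`
(where `u = |U|`, `d = |D|`). -/
def wtW (y u d : ℕ) : Finset Loz :=
  westLoz (2 * y + 2 * u) ∪ (westLoz (2 * y + 2 * d)).image reflLoz

/-- The weight-`1/2` vertical lozenges on the western side of `W̄_{x,y}(U;D;B)`. -/
def wtWbar (y u d : ℕ) : Finset Loz :=
  westLoz (2 * y + 2 * u - 1) ∪ (westLoz (2 * y + 2 * d - 1)).image reflLoz

/-- `m - S = {m - s : s ∈ S}`. -/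
def mirrorSet (m : ℕ) (S : Finset ℕ) : Finset ℕ := S.image fun i => m - i

/-- The reflectively symmetric doubly-dented hexagon
`RS_{x,y}(U;D) = H_{x,y}(U ∪ ((x+y+2n+1)-U); D ∪ ((x+y+2n+1)-D))`. -/
def RSreg (x y n : ℕ) (U D : Finset ℕ) : Finset Tri :=
  Hreg x y (2 * n) (U ∪ mirrorSet (x + y + 2 * n + 1) U)
    (D ∪ mirrorSet (x + y + 2 * n + 1) D)

/-- Reflection of a lozenge over the vertical symmetry axis of a region whose
base on the line `l` spans the horizontal interval `[0, W]`. -/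
def vreflLoz (W : ℤ) (l : Loz) : Loz :=
  ((W - 1 - l.1.1 - l.1.2, l.1.2), (W - 2 - l.2.1 - l.2.2, l.2.2))

/-- The number of lozenge tilings of `R` (avoiding the barriers `F`) invariant
under the reflection over the vertical axis of a base of width `W`. -/
noncomputable def Msym (R : Finset Tri) (F : Finset Loz) (W : ℤ) : ℕ := by
  classical
  exact ((tilings R F).filter fun T => T.image (vreflLoz W) = T).card

/-- `M_r(RS_{x,y}(U;D;B))` : the number of reflectively symmetric lozenge
tilings of the symmetric doubly-dented hexagon with barriers at
`B ∪ ((x+y+2n+1)-B)`. -/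
noncomputable def Mr (x y n : ℕ) (U D B : Finset ℕ) : ℕ :=
  Msym (RSreg x y n U D)
    (barrierLoz (B ∪ mirrorSet (x + y + 2 * n + 1) B))
    ((x : ℤ) + (y : ℤ) + 2 * (n : ℤ))

/-- The skipping hyperfactorial: `H2 (2k) = 0! 2! ⋯ (2k-2)!` and
`H2 (2k+1) = 1! 3! ⋯ (2k-1)!`. -/
def H2 (n : ℕ) : ℕ :=
  ∏ j ∈ (Finset.range n).filter (fun j => j % 2 = n % 2), Nat.factorial j

/-- `∏_{1 ≤ i < j ≤ k} (s_j² - s_i²)` for the increasing enumeration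
`s_1 < ⋯ < s_k` of `S`. -/
def prodDiffSq (S : Finset ℕ) : ℚ :=
  ∏ p ∈ S, ∏ q ∈ S.filter (fun q => p < q), ((q : ℚ) ^ 2 - (p : ℚ) ^ 2)

/-- `∏_{1 ≤ i < j ≤ k} (s_j - s_i)`. -/
def prodDiff (S : Finset ℕ) : ℚ :=
  ∏ p ∈ S, ∏ q ∈ S.filter (fun q => p < q), ((q : ℚ) - (p : ℚ))

/-- `∏_{1 ≤ i < j ≤ k} (s_j - s_i)(s_j + s_i - 1)`. -/
def prodDS1 (S : Finset ℕ) : ℚ :=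
  ∏ p ∈ S, ∏ q ∈ S.filter (fun q => p < q), (((q : ℚ) - (p : ℚ)) * ((q : ℚ) + (p : ℚ) - 1))

/-- `∏_{1 ≤ i < j ≤ k} (s_j - s_i)(s_j + s_i - 2)`. -/
def prodDS2 (S : Finset ℕ) : ℚ :=
  ∏ p ∈ S, ∏ q ∈ S.filter (fun q => p < q), (((q : ℚ) - (p : ℚ)) * ((q : ℚ) + (p : ℚ) - 2))

/-- `∏_{1 ≤ i < j ≤ k} (s_i + s_j)`. -/
def prodSum0 (S : Finset ℕ) : ℚ :=
  ∏ p ∈ S, ∏ q ∈ S.filter (fun q => p < q), ((q : ℚ) + (p : ℚ))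

/-- `∏_{1 ≤ i < j ≤ k} (s_i + s_j - 1)`. -/
def prodSum1 (S : Finset ℕ) : ℚ :=
  ∏ p ∈ S, ∏ q ∈ S.filter (fun q => p < q), ((q : ℚ) + (p : ℚ) - 1)

/-- `∏_{1 ≤ i < j ≤ k} (s_i + s_j - 2)`. -/
def prodSum2 (S : Finset ℕ) : ℚ :=
  ∏ p ∈ S, ∏ q ∈ S.filter (fun q => p < q), ((q : ℚ) + (p : ℚ) - 2)

/-- `∏_{1 ≤ i ≤ j ≤ k} (s_i + s_j - 1)` (the diagonal `i = j` included). -/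
def prodSumLe1 (S : Finset ℕ) : ℚ :=
  ∏ p ∈ S, ∏ q ∈ S.filter (fun q => p ≤ q), ((q : ℚ) + (p : ℚ) - 1)

theorem mem_tilings {R : Finset Tri} {F T : Finset Loz} :
    T ∈ tilings R F ↔ IsTiling R T ∧ ∀ l ∈ T, l ∉ F := by
  classical
  simp only [tilings, Finset.mem_filter, Finset.mem_powerset, and_iff_right_iff_imp]
  rintro ⟨h, -⟩ l hl
  obtain ⟨-, h1, h2⟩ := h.1 l hl
  exact Finset.mem_product.2 ⟨Finset.mem_image.2 ⟨_, h1, rfl⟩, Finset.mem_image.2 ⟨_, h2, rfl⟩⟩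

/-- Tilings described separately on up-pointing and down-pointing triangles. -/
theorem isTiling_iff {R : Finset Tri} {T : Finset Loz} :
    IsTiling R T ↔
      (∀ p q, (p, q) ∈ T → (q = p ∨ q = (p.1 - 1, p.2) ∨ q = (p.1, p.2 - 1)) ∧
        (true, p) ∈ R ∧ (false, q) ∈ R) ∧
      (∀ p, (true, p) ∈ R → ∃ q, (p, q) ∈ T) ∧
      (∀ q, (false, q) ∈ R → ∃ p, (p, q) ∈ T) ∧
      (∀ p q q', (p, q) ∈ T → (p, q') ∈ T → q = q') ∧
      (∀ p p' q, (p, q) ∈ T → (p', q) ∈ T → p = p') := by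
  constructor
  · rintro ⟨h1, h2⟩
    refine ⟨fun p q h => h1 _ h, fun p hp => ?_, fun q hq => ?_, fun p q q' h h' => ?_,
      fun p p' q h h' => ?_⟩
    · obtain ⟨⟨p', q⟩, ⟨hl, h | h⟩, -⟩ := h2 _ hp
      · simp only [upT, Prod.mk.eta, Prod.mk.injEq, true_and] at h
        exact ⟨q, h ▸ hl⟩
      · simp [dnT] at h
    · obtain ⟨⟨p, q'⟩, ⟨hl, h | h⟩, -⟩ := h2 _ hq
      · simp [upT] at h
      · simp only [dnT, Prod.mk.eta, Prod.mk.injEq, true_and] at h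
        exact ⟨p, h ▸ hl⟩
    · have := (h2 _ (h1 _ h).2.1).unique ⟨h, Or.inl rfl⟩ ⟨h', Or.inl rfl⟩
      exact (Prod.mk.inj this).2
    · have := (h2 _ (h1 _ h).2.2).unique ⟨h, Or.inr rfl⟩ ⟨h', Or.inr rfl⟩
      exact (Prod.mk.inj this).1
  · rintro ⟨h1, h2, h3, h4, h5⟩
    refine ⟨fun l hl => h1 l.1 l.2 hl, ?_⟩
    rintro ⟨b, p⟩ ht
    cases b
    · obtain ⟨q, hq⟩ := h3 p ht
      refine ⟨(q, p), ⟨hq, Or.inr rfl⟩, ?_⟩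
      rintro ⟨q', p'⟩ ⟨hl, h | h⟩
      · simp [upT] at h
      · simp only [dnT, Prod.mk.eta, Prod.mk.injEq, true_and] at h
        subst h
        rw [h5 _ _ _ hl hq]
    · obtain ⟨q, hq⟩ := h2 p ht
      refine ⟨(p, q), ⟨hq, Or.inl rfl⟩, ?_⟩
      rintro ⟨p', q'⟩ ⟨hl, h | h⟩
      · simp only [upT, Prod.mk.eta, Prod.mk.injEq, true_and] at h
        subst h
        rw [h4 _ _ _ hl hq]
      · simp [dnT] at h

theorem Mtil_empty : Mtil ∅ ∅ = 1 := by
  rw [Mtil, Finset.card_eq_one]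
  refine ⟨∅, Finset.eq_singleton_iff_unique_mem.2 ⟨?_, fun T hT => ?_⟩⟩
  · rw [mem_tilings]
    exact ⟨⟨by simp, by simp⟩, by simp⟩
  · rw [mem_tilings] at hT
    refine Finset.eq_empty_of_forall_notMem fun l hl => ?_
    simpa using (hT.1.1 l hl).2.1

/-- The vertical lozenge at abscissa `x` crossing the lattice line at height `h`. -/
def vertLoz (h x : ℤ) : Loz := ((x, h), (x, h - 1))

/-- Cutting a region along a horizontal lattice line: a tiling is determined by the vertical
lozenges crossing the line and by the tilings it induces on both sides. -/
theorem Mtil_union (h : ℤ) (R₁ R₂ : Finset Tri) (F : Finset Loz) (X : Finset ℤ)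
    (h₁ : ∀ t ∈ R₁, h ≤ t.2.2) (h₂ : ∀ t ∈ R₂, t.2.2 < h)
    (hF : ∀ l ∈ F, l.1.2 = h ∧ l.2.2 = h - 1)
    (hX : ∀ x, x ∈ X ↔ upT x h ∈ R₁ ∧ dnT x (h - 1) ∈ R₂ ∧ vertLoz h x ∉ F) :
    Mtil (R₁ ∪ R₂) F = ∑ S ∈ X.powerset,
      Mtil (R₁ \ S.image fun x => upT x h) ∅ *
        Mtil (R₂ \ S.image fun x => dnT x (h - 1)) ∅ := by
  classical
  have key : ∀ T ∈ tilings (R₁ ∪ R₂) F, X.filter (fun x => vertLoz h x ∈ T) ∈ X.powerset :=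
    fun T _ => Finset.mem_powerset.2 (Finset.filter_subset _ _)
  have mu₁ : ∀ (S : Finset ℤ) (p : ℤ × ℤ), (true, p) ∈ R₁ \ S.image (fun x => upT x h) ↔
      (true, p) ∈ R₁ ∧ ¬ (p.2 = h ∧ p.1 ∈ S) := by
    rintro S ⟨a, j⟩
    simp only [upT, Finset.mem_sdiff, Finset.mem_image, Prod.mk.injEq, true_and]
    grind
  have md₁ : ∀ (S : Finset ℤ) (q : ℤ × ℤ), (false, q) ∈ R₁ \ S.image (fun x => upT x h) ↔
      (false, q) ∈ R₁ := by
    rintro S ⟨a, j⟩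
    simp [upT]
  have mu₂ : ∀ (S : Finset ℤ) (p : ℤ × ℤ), (true, p) ∈ R₂ \ S.image (fun x => dnT x (h - 1)) ↔
      (true, p) ∈ R₂ := by
    rintro S ⟨a, j⟩
    simp [dnT]
  have md₂ : ∀ (S : Finset ℤ) (q : ℤ × ℤ), (false, q) ∈ R₂ \ S.image (fun x => dnT x (h - 1)) ↔
      (false, q) ∈ R₂ ∧ ¬ (q.2 = h - 1 ∧ q.1 ∈ S) := by
    rintro S ⟨a, j⟩
    simp only [dnT, Finset.mem_sdiff, Finset.mem_image, Prod.mk.injEq, true_and]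
    grind
  have hb₁ : ∀ b (p : ℤ × ℤ), (b, p) ∈ R₁ → h ≤ p.2 := fun b p hp => h₁ _ hp
  have hb₂ : ∀ b (p : ℤ × ℤ), (b, p) ∈ R₂ → p.2 < h := fun b p hp => h₂ _ hp
  have hX' : ∀ x, x ∈ X ↔ (true, x, h) ∈ R₁ ∧ (false, x, h - 1) ∈ R₂ ∧ ((x, h), (x, h - 1)) ∉ F := hX
  have hF' : ∀ (p q : ℤ × ℤ), (p, q) ∈ F → p.2 = h ∧ q.2 = h - 1 := fun p q hl => hF _ hl
  rw [Mtil, Finset.card_eq_sum_card_fiberwise key]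
  refine Finset.sum_congr rfl fun S hS => ?_
  rw [Mtil, Mtil, ← Finset.card_product]
  rw [Finset.mem_powerset] at hS
  refine Finset.card_nbij' (fun T => (T.filter fun l => h ≤ l.2.2, T.filter fun l => l.1.2 < h))
    (fun P => P.1 ∪ P.2 ∪ S.image (vertLoz h)) ?_ ?_ ?_ ?_
  · intro T hT
    simp only [Finset.coe_filter, Set.mem_ofPred_eq, mem_tilings, isTiling_iff,
      Finset.mem_union] at hT
    obtain ⟨⟨⟨a1, a2, a3, a4, a5⟩, a6⟩, rfl⟩ := hT
    have c : ∀ p q, (p, q) ∈ T →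
        (h ≤ q.2 ∧ h ≤ p.2 ∧ (true, p) ∈ R₁ ∧ (false, q) ∈ R₁) ∨
        (p.2 < h ∧ q.2 < h ∧ (true, p) ∈ R₂ ∧ (false, q) ∈ R₂) ∨
        (p = (p.1, h) ∧ q = (p.1, h - 1) ∧ p.1 ∈ X) := by
      rintro ⟨a, j⟩ ⟨a', j'⟩ hl
      obtain ⟨b1, b2, b3⟩ := a1 _ _ hl
      have b4 := a6 _ hl
      simp only [Prod.mk.injEq] at b1
      rcases b2 with b2 | b2
      · have b5 := hb₁ _ _ b2
        rcases b3 with b3 | b3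
        · have b6 := hb₁ _ _ b3
          exact Or.inl ⟨b6, b5, b2, b3⟩
        · have b6 := hb₂ _ _ b3
          dsimp only at b5 b6
          obtain ⟨rfl, rfl, rfl⟩ : j = h ∧ j' = h - 1 ∧ a' = a := by omega
          exact Or.inr (Or.inr ⟨rfl, rfl, (hX' _).2 ⟨b2, b3, b4⟩⟩)
      · have b5 := hb₂ _ _ b2
        rcases b3 with b3 | b3
        · have b6 := hb₁ _ _ b3
          dsimp only at b5 b6
          omega
        · have b6 := hb₂ _ _ b3
          exact Or.inr (Or.inl ⟨b5, b6, b2, b3⟩)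
    simp only [Finset.coe_product, Set.mem_prod, Finset.mem_coe, mem_tilings, isTiling_iff,
      mu₁, md₁, mu₂, md₂, Finset.mem_filter, Finset.notMem_empty, not_false_eq_true,
      implies_true, and_true]
    simp only [vertLoz]
    refine ⟨⟨?_, ?_, ?_, ?_, ?_⟩, ⟨?_, ?_, ?_, ?_, ?_⟩⟩
    · rintro p q ⟨hl, hq⟩
      obtain ⟨c1, c2, c3, c4⟩ | ⟨c1, c2, -⟩ | ⟨c1, c2, -⟩ := c p q hl
      · refine ⟨(a1 _ _ hl).1, ⟨c3, fun hp => ?_⟩, c4⟩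
        have := a4 p q (p.1, h - 1) hl (by
          obtain ⟨p1, p2⟩ := p
          obtain ⟨rfl, -, hp⟩ := hp
          exact hp)
        rw [this] at c1
        dsimp only at c1
        omega
      · omega
      · rw [c2] at hq
        dsimp only at hq
        omega
    · rintro p ⟨hp, hn⟩
      obtain ⟨q, hq⟩ := a2 p (Or.inl hp)
      refine ⟨q, hq, ?_⟩
      have hp' := hb₁ _ _ hp
      obtain ⟨c1, -⟩ | ⟨c1, -⟩ | ⟨c1, c2, c3⟩ := c p q hq
      · exact c1
      · omega
      · refine absurd ⟨congrArg Prod.snd c1, c3, ?_⟩ hn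
        rw [← c1, ← c2]
        exact hq
    · rintro q hq
      obtain ⟨p, hp⟩ := a3 q (Or.inl hq)
      exact ⟨p, hp, hb₁ _ _ hq⟩
    · exact fun p q q' hl hl' => a4 _ _ _ hl.1 hl'.1
    · exact fun p p' q hl hl' => a5 _ _ _ hl.1 hl'.1
    · rintro p q ⟨hl, hq⟩
      obtain ⟨c1, c2, -⟩ | ⟨c1, c2, c3, c4⟩ | ⟨c1, c2, -⟩ := c p q hl
      · omega
      · refine ⟨(a1 _ _ hl).1, c3, c4, fun hp => ?_⟩
        have := a5 p (q.1, h) q hl (by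
          obtain ⟨q1, q2⟩ := q
          obtain ⟨rfl, -, hp⟩ := hp
          exact hp)
        rw [this] at c1
        dsimp only at c1
        omega
      · rw [c1] at hq
        dsimp only at hq
        omega
    · rintro p hp
      obtain ⟨q, hq⟩ := a2 p (Or.inr hp)
      exact ⟨q, hq, hb₂ _ _ hp⟩
    · rintro q ⟨hq, hn⟩
      obtain ⟨p, hp⟩ := a3 q (Or.inr hq)
      refine ⟨p, hp, ?_⟩
      have hq' := hb₂ _ _ hq
      obtain ⟨c1, -⟩ | ⟨c1, -⟩ | ⟨c1, c2, c3⟩ := c p q hp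
      · omega
      · exact c1
      · have e : q.1 = p.1 := by rw [c2]
        refine absurd ⟨by rw [c2], ?_, ?_⟩ hn
        · rw [e]; exact c3
        · rw [e, ← c1, ← c2]
          exact hp
    · exact fun p q q' hl hl' => a4 _ _ _ hl.1 hl'.1
    · exact fun p p' q hl hl' => a5 _ _ _ hl.1 hl'.1
  · rintro ⟨T₁, T₂⟩ hT
    simp only [Finset.coe_product, Set.mem_prod, Finset.mem_coe, mem_tilings, isTiling_iff,
      mu₁, md₁, mu₂, md₂, Finset.notMem_empty, not_false_eq_true,
      implies_true, and_true] at hT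
    obtain ⟨⟨a1, a2, a3, a4, a5⟩, ⟨b1, b2, b3, b4, b5⟩⟩ := hT
    have mem : ∀ p q, (p, q) ∈ T₁ ∪ T₂ ∪ S.image (vertLoz h) ↔
        (p, q) ∈ T₁ ∨ (p, q) ∈ T₂ ∨ (p.2 = h ∧ p.1 ∈ S ∧ q = (p.1, h - 1)) := by
      rintro ⟨a, j⟩ q
      simp only [vertLoz, Finset.mem_union, Finset.mem_image, Prod.mk.injEq]
      grind
    have A : ∀ p q, (p, q) ∈ T₁ → h ≤ p.2 ∧ h ≤ q.2 ∧ ¬ (p.2 = h ∧ p.1 ∈ S) := fun p q hl =>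
      ⟨hb₁ _ _ (a1 p q hl).2.1.1, hb₁ _ _ (a1 p q hl).2.2, (a1 p q hl).2.1.2⟩
    have B : ∀ p q, (p, q) ∈ T₂ → p.2 < h ∧ q.2 < h ∧ ¬ (q.2 = h - 1 ∧ q.1 ∈ S) := fun p q hl =>
      ⟨hb₂ _ _ (b1 p q hl).2.1, hb₂ _ _ (b1 p q hl).2.2.1, (b1 p q hl).2.2.2⟩
    simp only [Finset.coe_filter, Set.mem_ofPred_eq, mem_tilings, isTiling_iff,
      Finset.mem_union (s := R₁)]
    refine ⟨⟨⟨?_, ?_, ?_, ?_, ?_⟩, ?_⟩, ?_⟩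
    · intro p q hl
      rw [mem] at hl
      rcases hl with hl | hl | ⟨rfl, hl, rfl⟩
      · obtain ⟨c1, c2, c3⟩ := a1 _ _ hl
        exact ⟨c1, Or.inl c2.1, Or.inl c3⟩
      · obtain ⟨c1, c2, c3⟩ := b1 _ _ hl
        exact ⟨c1, Or.inr c2, Or.inr c3.1⟩
      · obtain ⟨c1, c2, -⟩ := (hX' _).1 (hS hl)
        exact ⟨Or.inr (Or.inr rfl), Or.inl c1, Or.inr c2⟩
    · intro p hp
      simp only [mem]
      rcases hp with hp | hp
      · by_cases hc : p.2 = h ∧ p.1 ∈ S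
        · exact ⟨_, Or.inr (Or.inr ⟨hc.1, hc.2, rfl⟩)⟩
        · obtain ⟨q, hq⟩ := a2 p ⟨hp, hc⟩
          exact ⟨q, Or.inl hq⟩
      · obtain ⟨q, hq⟩ := b2 p hp
        exact ⟨q, Or.inr (Or.inl hq)⟩
    · intro q hq
      simp only [mem]
      rcases hq with hq | hq
      · obtain ⟨p, hp⟩ := a3 q hq
        exact ⟨p, Or.inl hp⟩
      · by_cases hc : q.2 = h - 1 ∧ q.1 ∈ S
        · exact ⟨(q.1, h), Or.inr (Or.inr ⟨rfl, hc.2, by rw [← hc.1]⟩)⟩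
        · obtain ⟨p, hp⟩ := b3 q ⟨hq, hc⟩
          exact ⟨p, Or.inr (Or.inl hp)⟩
    · intro p q q' hl hl'
      rw [mem] at hl hl'
      rcases hl with hl | hl | ⟨e1, e2, rfl⟩ <;> rcases hl' with hl' | hl' | ⟨e1', e2', rfl⟩
      · exact a4 _ _ _ hl hl'
      · have := A _ _ hl; have := B _ _ hl'; omega
      · exact absurd ⟨e1', e2'⟩ (A _ _ hl).2.2
      · have := B _ _ hl; have := A _ _ hl'; omega
      · exact b4 _ _ _ hl hl'
      · have := B _ _ hl; omega
      · exact absurd ⟨e1, e2⟩ (A _ _ hl').2.2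
      · have := B _ _ hl'; omega
      · rfl
    · intro p p' q hl hl'
      rw [mem] at hl hl'
      rcases hl with hl | hl | ⟨e1, e2, rfl⟩ <;> rcases hl' with hl' | hl' | ⟨e1', e2', e⟩
      · exact a5 _ _ _ hl hl'
      · have := A _ _ hl; have := B _ _ hl'; omega
      · have := A _ _ hl
        rw [e] at this
        dsimp only at this
        omega
      · have := B _ _ hl; have := A _ _ hl'; omega
      · exact b5 _ _ _ hl hl'
      · refine absurd ⟨?_, ?_⟩ (B _ _ hl).2.2 <;> rw [e]
        exact e2'
      · have := A _ _ hl'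
        dsimp only at this
        omega
      · exact absurd ⟨rfl, e2⟩ (B _ _ hl').2.2
      · exact Prod.ext (Prod.mk.inj e).1 (e1.trans e1'.symm)
    · rintro ⟨p, q⟩ hl hf
      rw [mem] at hl
      have := hF' _ _ hf
      rcases hl with hl | hl | ⟨rfl, hl, rfl⟩
      · have := A _ _ hl; omega
      · have := B _ _ hl; omega
      · exact ((hX' _).1 (hS hl)).2.2 hf
    · ext x
      rw [Finset.mem_filter, vertLoz, mem]
      constructor
      · rintro ⟨-, hl | hl | ⟨-, hl, -⟩⟩
        · have := A _ _ hl
          dsimp only at this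
          omega
        · have := B _ _ hl
          dsimp only at this
          omega
        · exact hl
      · exact fun hx => ⟨hS hx, Or.inr (Or.inr ⟨rfl, hx, rfl⟩)⟩
  · intro T hT
    simp only [Finset.coe_filter, Set.mem_ofPred_eq, mem_tilings, isTiling_iff,
      Finset.mem_union] at hT
    obtain ⟨⟨⟨a1, a2, a3, a4, a5⟩, a6⟩, rfl⟩ := hT
    ext ⟨⟨a, j⟩, ⟨a', j'⟩⟩
    simp only [Finset.mem_union, Finset.mem_filter, Finset.mem_image]
    simp only [vertLoz, Prod.mk.injEq]
    constructor
    · rintro ((h | h) | ⟨x, ⟨-, h⟩, ⟨rfl, rfl⟩, rfl, rfl⟩)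
      exacts [h.1, h.1, h]
    · intro hl
      obtain ⟨b1, b2, b3⟩ := a1 _ _ hl
      have b4 := a6 _ hl
      simp only [Prod.mk.injEq] at b1
      by_cases c1 : h ≤ j'
      · exact Or.inl (Or.inl ⟨hl, c1⟩)
      · by_cases c2 : j < h
        · exact Or.inl (Or.inr ⟨hl, c2⟩)
        · obtain ⟨rfl, rfl, rfl⟩ : j = h ∧ j' = h - 1 ∧ a' = a := by omega
          refine Or.inr ⟨a', ⟨(hX' _).2 ⟨?_, ?_, b4⟩, hl⟩, ⟨rfl, rfl⟩, rfl, rfl⟩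
          · exact b2.resolve_right fun hc => absurd (hb₂ _ _ hc) (by simp)
          · exact b3.resolve_left fun hc => absurd (hb₁ _ _ hc) (by simp)
  · rintro ⟨T₁, T₂⟩ hT
    simp only [Finset.coe_product, Set.mem_prod, Finset.mem_coe, mem_tilings, isTiling_iff,
      mu₁, md₁, mu₂, md₂, Finset.notMem_empty, not_false_eq_true,
      implies_true, and_true] at hT
    obtain ⟨⟨a1, -⟩, ⟨b1, -⟩⟩ := hT
    have A : ∀ p q, (p, q) ∈ T₁ → h ≤ p.2 ∧ h ≤ q.2 := fun p q hl =>
      ⟨hb₁ _ _ (a1 p q hl).2.1.1, hb₁ _ _ (a1 p q hl).2.2⟩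
    have B : ∀ p q, (p, q) ∈ T₂ → p.2 < h ∧ q.2 < h := fun p q hl =>
      ⟨hb₂ _ _ (b1 p q hl).2.1, hb₂ _ _ (b1 p q hl).2.2.1⟩
    have C : ∀ p q, (p, q) ∈ S.image (vertLoz h) → p.2 = h ∧ q.2 = h - 1 := by
      intro p q hl
      obtain ⟨x, -, e⟩ := Finset.mem_image.1 hl
      rw [vertLoz, Prod.mk.injEq] at e
      exact ⟨by rw [← e.1], by rw [← e.2]⟩
    refine Prod.ext ?_ ?_
    · ext ⟨p, q⟩
      simp only [Finset.mem_filter, Finset.mem_union]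
      constructor
      · rintro ⟨(hl | hl) | hl, hq⟩
        · exact hl
        · have := B _ _ hl; omega
        · have := C _ _ hl; omega
      · exact fun hl => ⟨Or.inl (Or.inl hl), (A _ _ hl).2⟩
    · ext ⟨p, q⟩
      simp only [Finset.mem_filter, Finset.mem_union]
      constructor
      · rintro ⟨(hl | hl) | hl, hq⟩
        · have := A _ _ hl; omega
        · exact hl
        · have := C _ _ hl; omega
      · exact fun hl => ⟨Or.inl (Or.inr hl), (B _ _ hl).1⟩

theorem reflTri_involutive : Function.Involutive reflTri := by
  rintro ⟨b, a, j⟩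
  cases b
  · simp [reflTri]
  · simp [reflTri]
    omega

theorem reflLoz_involutive : Function.Involutive reflLoz := by
  rintro ⟨⟨a, j⟩, ⟨a', j'⟩⟩
  simp only [reflLoz, Prod.mk.injEq]
  omega

theorem IsTiling.image_refl {R : Finset Tri} {T : Finset Loz} (h : IsTiling R T) :
    IsTiling (R.image reflTri) (T.image reflLoz) := by
  rw [isTiling_iff] at h ⊢
  obtain ⟨a1, a2, a3, a4, a5⟩ := h
  have mR : ∀ t, t ∈ R.image reflTri ↔ reflTri t ∈ R := fun t => by
    rw [Finset.mem_image]
    exact ⟨fun ⟨s, hs, e⟩ => by rw [← e, reflTri_involutive]; exact hs,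
      fun ht => ⟨_, ht, reflTri_involutive t⟩⟩
  have mT : ∀ p q, (p, q) ∈ T.image reflLoz ↔ reflLoz (p, q) ∈ T := fun p q => by
    rw [Finset.mem_image]
    exact ⟨fun ⟨s, hs, e⟩ => by rw [← e, reflLoz_involutive]; exact hs,
      fun ht => ⟨_, ht, reflLoz_involutive _⟩⟩
  simp only [mR, mT, reflLoz, reflTri, if_true, Bool.false_eq_true, if_false]
  refine ⟨?_, ?_, ?_, ?_, ?_⟩
  · rintro ⟨a, j⟩ ⟨a', j'⟩ hl
    obtain ⟨b1, b2, b3⟩ := a1 _ _ hl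
    refine ⟨?_, b3, b2⟩
    simp only [Prod.mk.injEq] at b1 ⊢
    omega
  · rintro ⟨a, j⟩ hp
    obtain ⟨⟨b, i⟩, hl⟩ := a3 _ hp
    refine ⟨(b + i, -i - 1), ?_⟩
    convert hl using 3 <;> dsimp only <;> omega
  · rintro ⟨a, j⟩ hp
    obtain ⟨⟨b, i⟩, hl⟩ := a2 _ hp
    refine ⟨(b + i + 1, -i - 1), ?_⟩
    convert hl using 3 <;> dsimp only <;> omega
  · rintro ⟨a, j⟩ ⟨b, i⟩ ⟨b', i'⟩ h h'
    have := a5 _ _ _ h h'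
    simp only [Prod.mk.injEq] at this ⊢
    omega
  · rintro ⟨b, i⟩ ⟨b', i'⟩ ⟨a, j⟩ h h'
    have := a4 _ _ _ h h'
    simp only [Prod.mk.injEq] at this ⊢
    omega

theorem Mtil_image_refl (R : Finset Tri) : Mtil (R.image reflTri) ∅ = Mtil R ∅ := by
  have inv : ∀ T : Finset Loz, (T.image reflLoz).image reflLoz = T := fun T => by
    rw [Finset.image_image, reflLoz_involutive.comp_self, Finset.image_id]
  refine Finset.card_nbij' (Finset.image reflLoz) (Finset.image reflLoz) ?_ ?_
    (fun T _ => inv T) (fun T _ => inv T)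
  · intro T hT
    simp only [Finset.mem_coe, mem_tilings, Finset.notMem_empty, not_false_eq_true, implies_true,
      and_true] at hT ⊢
    have := hT.image_refl
    rwa [Finset.image_image, reflTri_involutive.comp_self, Finset.image_id] at this
  · intro T hT
    simp only [Finset.mem_coe, mem_tilings, Finset.notMem_empty, not_false_eq_true, implies_true,
      and_true] at hT ⊢
    exact hT.image_refl

/-- The row of unit triangles at height `j` with up-pointing triangles at abscissas `P` and
down-pointing triangles at abscissas `Q`. -/
def rowReg (j : ℤ) (P Q : Finset ℤ) : Finset Tri :=
  (P.image fun x => upT x j) ∪ Q.image fun x => dnT x j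

/-- Number of elements of `P` to the left of `x`. -/
def cnt (P : Finset ℤ) (x : ℤ) : ℕ := (P.filter (· < x)).card

theorem cnt_succ (P : Finset ℤ) (x : ℤ) : cnt P (x + 1) = cnt P x + if x ∈ P then 1 else 0 := by
  have : P.filter (· < x + 1) = P.filter (· < x) ∪ P.filter (· = x) := by
    ext y
    simp only [Finset.mem_filter, Finset.mem_union]
    grind
  rw [cnt, this, Finset.card_union_of_disjoint, Finset.filter_eq', cnt]
  · split_ifs <;> simp
  · rw [Finset.disjoint_filter]
    intro y _ h
    omega

theorem cnt_le_card (P : Finset ℤ) (x : ℤ) : cnt P x ≤ P.card :=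
  Finset.card_filter_le _ _

/-- The condition for a row of unit triangles to have a lozenge tiling. -/
def RowOK (P Q : Finset ℤ) : Prop := ∀ x, cnt P x ≤ cnt Q x ∧ cnt Q x ≤ cnt P (x + 1)

theorem mem_rowReg {j : ℤ} {P Q : Finset ℤ} :
    (∀ p : ℤ × ℤ, (true, p) ∈ rowReg j P Q ↔ p.1 ∈ P ∧ p.2 = j) ∧
    (∀ p : ℤ × ℤ, (false, p) ∈ rowReg j P Q ↔ p.1 ∈ Q ∧ p.2 = j) := by
  constructor <;> rintro ⟨a, b⟩ <;>
    simp [rowReg, upT, dnT, eq_comm]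

/-- A tiling of a row matches the up-pointing triangles with adjacent down-pointing triangles. -/
theorem exists_matching_of_isTiling {j : ℤ} {P Q : Finset ℤ} {T : Finset Loz}
    (h : IsTiling (rowReg j P Q) T) :
    ∃ σ τ : ℤ → ℤ,
      (∀ x ∈ P, σ x ∈ Q ∧ (σ x = x ∨ σ x = x - 1) ∧ ((x, j), (σ x, j)) ∈ T ∧ τ (σ x) = x) ∧
      (∀ y ∈ Q, τ y ∈ P ∧ (y = τ y ∨ y = τ y - 1) ∧ σ (τ y) = y) ∧
      ∀ l ∈ T, ∃ x ∈ P, l = ((x, j), (σ x, j)) := by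
  rw [isTiling_iff] at h
  simp only [mem_rowReg.1, mem_rowReg.2] at h
  obtain ⟨a1, a2, a3, a4, a5⟩ := h
  have b1 : ∀ x x' i i', ((x, i), (x', i')) ∈ T →
      (x' = x ∨ x' = x - 1) ∧ i = j ∧ i' = j ∧ x ∈ P ∧ x' ∈ Q := by
    intro x x' i i' hl
    have := a1 _ _ hl
    simp only [Prod.mk.injEq] at this
    grind
  have f1 : ∀ x ∈ P, ∃ x' ∈ Q, (x' = x ∨ x' = x - 1) ∧ ((x, j), (x', j)) ∈ T := by
    intro x hx
    obtain ⟨⟨x', i⟩, hl⟩ := a2 (x, j) ⟨hx, rfl⟩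
    obtain ⟨c1, -, rfl, c2, c3⟩ := b1 _ _ _ _ hl
    exact ⟨x', c3, c1, hl⟩
  have f2 : ∀ x' ∈ Q, ∃ x ∈ P, (x' = x ∨ x' = x - 1) ∧ ((x, j), (x', j)) ∈ T := by
    intro x hx
    obtain ⟨⟨x', i⟩, hl⟩ := a3 (x, j) ⟨hx, rfl⟩
    obtain ⟨c1, rfl, -, c2, c3⟩ := b1 _ _ _ _ hl
    exact ⟨x', c2, c1, hl⟩
  choose! σ s1 s2 s3 using f1
  choose! τ t1 t2 t3 using f2
  refine ⟨σ, τ, fun x hx => ⟨s1 x hx, s2 x hx, s3 x hx, ?_⟩, fun y hy => ⟨t1 y hy, t2 y hy, ?_⟩, ?_⟩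
  · have := a5 _ _ _ (s3 x hx) (t3 _ (s1 x hx))
    simpa using this.symm
  · have := a4 _ _ _ (t3 y hy) (s3 _ (t1 y hy))
    simpa using this.symm
  · rintro ⟨⟨x, i⟩, ⟨x', i'⟩⟩ hl
    obtain ⟨-, rfl, rfl, hx, -⟩ := b1 _ _ _ _ hl
    exact ⟨x, hx, Prod.ext rfl (a4 _ _ _ hl (s3 x hx))⟩

/-- The partner of the up-pointing triangle at abscissa `x` in the only possible tiling of a
row. -/
def partner (P Q : Finset ℤ) (x : ℤ) : ℤ := if cnt Q x = cnt P x then x else x - 1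

theorem rowOK_of_isTiling {j : ℤ} {P Q : Finset ℤ} {T : Finset Loz}
    (h : IsTiling (rowReg j P Q) T) :
    RowOK P Q ∧ P.card = Q.card ∧ T = P.image fun x => ((x, j), (partner P Q x, j)) := by
  obtain ⟨σ, τ, s, t, hT⟩ := exists_matching_of_isTiling h
  have ok : RowOK P Q := by
    intro x
    constructor
    · refine Finset.card_le_card_of_injOn σ (fun y hy => ?_) (fun y hy z hz e => ?_)
      · simp only [Finset.coe_filter, Set.mem_ofPred_eq] at hy ⊢
        have := s y hy.1
        exact ⟨this.1, by omega⟩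
      · simp only [Finset.coe_filter, Set.mem_ofPred_eq] at hy hz
        rw [← (s y hy.1).2.2.2, e, (s z hz.1).2.2.2]
    · refine Finset.card_le_card_of_injOn τ (fun y hy => ?_) (fun y hy z hz e => ?_)
      · simp only [Finset.coe_filter, Set.mem_ofPred_eq] at hy ⊢
        have := t y hy.1
        exact ⟨this.1, by omega⟩
      · simp only [Finset.coe_filter, Set.mem_ofPred_eq] at hy hz
        rw [← (t y hy.1).2.2, e, (t z hz.1).2.2]
  have hp : ∀ x ∈ P, partner P Q x = σ x := by
    intro x hx
    have hx1 := cnt_succ P x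
    rw [if_pos hx] at hx1
    rcases (s x hx).2.1 with e | e
    · have : cnt Q x ≤ cnt P x := by
        refine Finset.card_le_card_of_injOn τ (fun y hy => ?_) (fun y hy z hz e => ?_)
        · simp only [Finset.coe_filter, Set.mem_ofPred_eq] at hy ⊢
          obtain ⟨h1, h2, h3⟩ := t y hy.1
          refine ⟨h1, ?_⟩
          have h2 : τ y ≠ x := fun h => by
            rw [h, e] at h3
            omega
          omega
        · simp only [Finset.coe_filter, Set.mem_ofPred_eq] at hy hz
          rw [← (t y hy.1).2.2, e, (t z hz.1).2.2]
      rw [partner, if_pos (le_antisymm this (ok x).1), e]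
    · have : cnt P x + 1 ≤ cnt Q x := by
        rw [← hx1]
        refine Finset.card_le_card_of_injOn σ (fun y hy => ?_) (fun y hy z hz e => ?_)
        · simp only [Finset.coe_filter, Set.mem_ofPred_eq] at hy ⊢
          have h1 := s y hy.1
          refine ⟨h1.1, ?_⟩
          rcases eq_or_ne y x with rfl | h2 <;> omega
        · simp only [Finset.coe_filter, Set.mem_ofPred_eq] at hy hz
          rw [← (s y hy.1).2.2.2, e, (s z hz.1).2.2.2]
      rw [partner, if_neg (by omega), e]
  refine ⟨ok, Finset.card_nbij' σ τ (fun x hx => (s x hx).1) (fun y hy => (t y hy).1)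
    (fun x hx => (s x hx).2.2.2) (fun y hy => (t y hy).2.2), ?_⟩
  ext l
  rw [Finset.mem_image]
  constructor
  · intro hl
    obtain ⟨x, hx, rfl⟩ := hT l hl
    exact ⟨x, hx, by rw [hp x hx]⟩
  · rintro ⟨x, hx, rfl⟩
    rw [hp x hx]
    exact (s x hx).2.2.1

theorem isTiling_row (j : ℤ) {P Q : Finset ℤ} (h : RowOK P Q) :
    IsTiling (rowReg j P Q) (P.image fun x => ((x, j), (partner P Q x, j))) := by
  have cP := cnt_succ P
  have cQ := cnt_succ Q
  have mem : ∀ p q, (p, q) ∈ P.image (fun x => ((x, j), (partner P Q x, j))) ↔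
      p.1 ∈ P ∧ p.2 = j ∧ q = (partner P Q p.1, j) := by
    rintro ⟨a, i⟩ q
    simp only [Finset.mem_image, Prod.mk.injEq]
    grind
  have mQ : ∀ x ∈ P, partner P Q x ∈ Q := by
    intro x hx
    have h1 := cP x
    have h2 := h x
    have h3 := h (x + 1)
    have h4 := h (x - 1)
    have h5 := cQ x
    have h6 := cQ (x - 1)
    rw [sub_add_cancel] at h4 h6
    rw [if_pos hx] at h1
    unfold partner
    split_ifs with hc
    · by_contra hq
      rw [if_neg hq] at h5
      omega
    · by_contra hq
      rw [if_neg hq] at h6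
      omega
  have inj : ∀ x ∈ P, ∀ y ∈ P, x < y → partner P Q x ≠ partner P Q y := by
    intro x hx y hy hxy e
    have h1 := cP x
    have h2 := cP y
    have h3 := cQ x
    rw [if_pos hx] at h1
    have h4 := h x
    have h5 := h y
    unfold partner at e
    obtain rfl : y = x + 1 := by split_ifs at e <;> omega
    split_ifs at e h3 <;> omega
  rw [isTiling_iff]
  simp only [mem_rowReg.1, mem_rowReg.2, mem]
  refine ⟨?_, ?_, ?_, ?_, ?_⟩
  · rintro ⟨a, i⟩ q ⟨h1, h2, rfl⟩
    dsimp only at h1 h2 ⊢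
    subst h2
    refine ⟨?_, ⟨h1, rfl⟩, mQ _ h1, rfl⟩
    unfold partner
    split_ifs <;> simp
  · rintro p ⟨h1, h2⟩
    exact ⟨_, h1, h2, rfl⟩
  · rintro ⟨y, i⟩ ⟨hy, rfl⟩
    dsimp only at hy ⊢
    have h1 := cP y
    have h2 := cP (y + 1)
    have h3 := cQ y
    have h4 := h y
    have h5 := h (y + 1)
    rw [if_pos hy] at h3
    by_cases hc : y ∈ P ∧ cnt Q y = cnt P y
    · exact ⟨(y, i), hc.1, rfl, by rw [partner, if_pos hc.2]⟩
    · refine ⟨(y + 1, i), ?_, rfl, ?_⟩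
      · by_contra hn
        simp only at hn
        rw [if_neg hn] at h2
        by_cases hy' : y ∈ P
        · simp only [hy', true_and] at hc
          rw [if_pos hy'] at h1
          omega
        · rw [if_neg hy'] at h1
          omega
      · have : cnt Q (y + 1) ≠ cnt P (y + 1) := by
          by_cases hy' : y ∈ P
          · simp only [hy', true_and] at hc
            rw [if_pos hy'] at h1
            omega
          · rw [if_neg hy'] at h1
            omega
        simp [partner, if_neg this]
  · rintro p q q' ⟨-, -, rfl⟩ ⟨-, -, rfl⟩
    rfl
  · rintro ⟨a, i⟩ ⟨b, i'⟩ q ⟨h1, h2, rfl⟩ ⟨h1', h2', e⟩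
    dsimp only at h1 h2 h1' h2' e
    rw [Prod.mk.injEq] at e
    rcases lt_trichotomy a b with hl | rfl | hl
    · exact absurd e.1 (inj _ h1 _ h1' hl)
    · rw [h2, h2']
    · exact absurd e.1.symm (inj _ h1' _ h1 hl)

theorem Mtil_rowReg_of_rowOK (j : ℤ) {P Q : Finset ℤ} (h : RowOK P Q) :
    Mtil (rowReg j P Q) ∅ = 1 := by
  rw [Mtil, Finset.card_eq_one]
  refine ⟨P.image fun x => ((x, j), (partner P Q x, j)), Finset.eq_singleton_iff_unique_mem.2
    ⟨mem_tilings.2 ⟨isTiling_row j h, by simp⟩, fun T hT => ?_⟩⟩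
  exact (rowOK_of_isTiling (mem_tilings.1 hT).1).2.2

theorem Mtil_rowReg_eq_zero (j : ℤ) {P Q : Finset ℤ} (h : ¬ (RowOK P Q ∧ P.card = Q.card)) :
    Mtil (rowReg j P Q) ∅ = 0 := by
  rw [Mtil, Finset.card_eq_zero]
  refine Finset.eq_empty_of_forall_notMem fun T hT => h ?_
  have := rowOK_of_isTiling (mem_tilings.1 hT).1
  exact ⟨this.1, this.2.1⟩

theorem cnt_sdiff {A I : Finset ℤ} (h : A ⊆ I) (x : ℤ) : cnt (I \ A) x + cnt A x = cnt I x := by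
  rw [cnt, cnt, ← Finset.card_union_of_disjoint, ← Finset.filter_union,
    Finset.sdiff_union_of_subset h, cnt]
  exact Finset.disjoint_filter_filter Finset.sdiff_disjoint

theorem cnt_Ico (L R x : ℤ) : cnt (Finset.Ico L R) x = (min R x - L).toNat := by
  rw [cnt, Finset.Ico_filter_lt, Int.card_Ico]

theorem cnt_eq_card {P : Finset ℤ} {x : ℤ} (h : ∀ p ∈ P, p < x) : cnt P x = P.card := by
  rw [cnt, Finset.filter_true_of_mem h]

theorem lt_cnt_image_iff {k : ℕ} {e : Fin k → ℤ} (he : StrictMono e) (i : Fin k) (x : ℤ) :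
    (i : ℕ) < cnt (Finset.univ.image e) x ↔ e i < x := by
  have h : cnt (Finset.univ.image e) x = (Finset.univ.filter fun i => e i < x).card := by
    rw [cnt, Finset.filter_image, Finset.card_image_of_injective _ he.injective]
  rw [h]
  constructor
  · intro hc
    by_contra hx
    have : (Finset.univ.filter fun i => e i < x) ⊆ Finset.Iio i := fun l hl => by
      simp only [Finset.mem_filter, Finset.mem_univ, true_and] at hl
      rw [Finset.mem_Iio]
      exact he.lt_iff_lt.1 (by omega)
    have := Finset.card_le_card this
    rw [Fin.card_Iio] at this
    omega
  · intro hx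
    have : Finset.Iic i ⊆ (Finset.univ.filter fun i => e i < x) := fun l hl => by
      simp only [Finset.mem_filter, Finset.mem_univ, true_and]
      exact (he.monotone (Finset.mem_Iic.1 hl)).trans_lt hx
    have := Finset.card_le_card this
    rw [Fin.card_Iic] at this
    omega

theorem cnt_image_le {k : ℕ} {e : Fin k → ℤ} (he : StrictMono e) (x : ℤ) (m : ℕ)
    (h : ∀ i : Fin k, e i < x → (i : ℕ) < m) : cnt (Finset.univ.image e) x ≤ m := by
  by_contra hc
  have hk : cnt (Finset.univ.image e) x ≤ k := by
    refine (cnt_le_card _ _).trans (Finset.card_image_le.trans ?_)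
    simp
  have := h ⟨m, by omega⟩ ((lt_cnt_image_iff he _ x).1 (by simpa using hc))
  simp at this

/-- Sequences interlacing with `e`. -/
noncomputable def interlacing {k : ℕ} (e : Fin (k + 1) → ℤ) : Finset (Fin k → ℤ) :=
  Fintype.piFinset fun i => Finset.Ico (e i.castSucc) (e i.succ)

theorem mem_interlacing {k : ℕ} {e : Fin (k + 1) → ℤ} {b : Fin k → ℤ} :
    b ∈ interlacing e ↔ ∀ i, e i.castSucc ≤ b i ∧ b i < e i.succ := by
  simp [interlacing]

theorem strictMono_of_mem_interlacing {k : ℕ} {e : Fin (k + 1) → ℤ} (he : StrictMono e)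
    {b : Fin k → ℤ} (hb : b ∈ interlacing e) : StrictMono b := by
  rw [mem_interlacing] at hb
  intro i j hij
  have : e i.succ ≤ e j.castSucc := he.monotone (by
    rw [Fin.le_def, Fin.val_succ, Fin.val_castSucc]; exact hij)
  have h1 := hb i
  have h2 := hb j
  omega

theorem rowOK_iff {k : ℕ} {e : Fin (k + 1) → ℤ} (he : StrictMono e) {L R : ℤ}
    (hL : ∀ i, L ≤ e i) (hR : ∀ i, e i < R) {S : Finset ℤ} (hS : S ⊆ Finset.Ico L (R - 1)) :
    RowOK (Finset.Ico L R \ Finset.univ.image e) (Finset.Ico L (R - 1) \ S) ↔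
      ∃ b ∈ interlacing e, Finset.univ.image b = S := by
  set A := Finset.univ.image e with hA
  have hAs : A ⊆ Finset.Ico L R := by
    intro x hx
    obtain ⟨i, -, rfl⟩ := Finset.mem_image.1 hx
    exact Finset.mem_Ico.2 ⟨hL i, hR i⟩
  have hAc : A.card = k + 1 := by
    rw [hA, Finset.card_image_of_injective _ he.injective]
    simp
  have cA := cnt_sdiff hAs
  have cS := cnt_sdiff hS
  simp only [cnt_Ico] at cA cS
  have hLR : L < R := (hL 0).trans_lt (hR 0)
  have AR : ∀ x, R ≤ x → cnt A x = k + 1 := fun x hx =>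
    (cnt_eq_card fun p hp => by have := Finset.mem_Ico.1 (hAs hp); omega).trans hAc
  have SR : ∀ x, R - 1 ≤ x → cnt S x = S.card := fun x hx =>
    cnt_eq_card fun p hp => by have := Finset.mem_Ico.1 (hS hp); omega
  have AL : ∀ x, x ≤ L → cnt A x = 0 := fun x hx => by
    have := cA x; omega
  have SL : ∀ x, x ≤ L → cnt S x = 0 := fun x hx => by
    have := cS x; omega
  have main : RowOK (Finset.Ico L R \ A) (Finset.Ico L (R - 1) \ S) ↔
      (∀ x, cnt S x ≤ cnt A x ∧ cnt A (x + 1) ≤ cnt S x + 1) ∧ S.card = k := by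
    constructor
    · intro h
      have hR := h R
      have h1 := cA R
      have h2 := cA (R + 1)
      have h3 := cS R
      have h4 := AR R le_rfl
      have h5 := AR (R + 1) (by omega)
      have h6 := SR R (by omega)
      refine ⟨fun x => ?_, by omega⟩
      have hx := h x
      have h7 := cA x
      have h8 := cA (x + 1)
      have h9 := cS x
      have := AR x
      have := AR (x + 1)
      have := SR x
      have := AL x
      have := AL (x + 1)
      have := SL x
      omega
    · rintro ⟨h, hc⟩ x
      have hx := h x
      have h7 := cA x
      have h8 := cA (x + 1)
      have h9 := cS x
      have := AR x
      have := AR (x + 1)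
      have := SR x
      have := AL x
      have := AL (x + 1)
      have := SL x
      omega
  rw [main]
  constructor
  · rintro ⟨h, hc⟩
    refine ⟨S.orderEmbOfFin hc, ?_, by simp⟩
    have hb := (S.orderEmbOfFin hc).strictMono
    have hi : Finset.univ.image (S.orderEmbOfFin hc) = S := by simp
    rw [mem_interlacing]
    intro i
    have h1 := lt_cnt_image_iff hb i
    rw [hi] at h1
    have hAe := lt_cnt_image_iff he
    rw [← hA] at hAe
    constructor
    · have h2 := (hAe i.castSucc (S.orderEmbOfFin hc i + 1)).1 (by
        have := (h (S.orderEmbOfFin hc i + 1)).1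
        have := (h1 (S.orderEmbOfFin hc i + 1)).2 (by omega)
        rw [Fin.val_castSucc]
        omega)
      omega
    · rw [← h1]
      have h2 := (hAe i.succ (e i.succ + 1)).2 (by omega)
      have h3 := (h (e i.succ)).2
      rw [Fin.val_succ] at h2
      omega
  · rintro ⟨b, hb, rfl⟩
    have hbm := strictMono_of_mem_interlacing he hb
    refine ⟨fun x => ?_, by rw [Finset.card_image_of_injective _ hbm.injective]; simp⟩
    rw [mem_interlacing] at hb
    constructor
    · refine cnt_image_le hbm x _ fun i hi => ?_
      have := (lt_cnt_image_iff he i.castSucc x).2 (by have := hb i; omega)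
      simpa using this
    · refine cnt_image_le he (x + 1) _ fun i hi => ?_
      induction i using Fin.cases with
      | zero => simp
      | succ i =>
        have := (lt_cnt_image_iff hbm i x).2 (by have := hb i; omega)
        simpa using this

theorem sum_Mtil_rowReg {k : ℕ} {e : Fin (k + 1) → ℤ} (he : StrictMono e) {L R : ℤ} (j : ℤ)
    (hL : ∀ i, L ≤ e i) (hR : ∀ i, e i < R) {X : Finset ℤ} (hX : X ⊆ Finset.Ico L (R - 1))
    (hb : ∀ b ∈ interlacing e, ∀ i, b i ∈ X) (G : Finset ℤ → ℕ) :
    ∑ S ∈ X.powerset, Mtil (rowReg j (Finset.Ico L R \ Finset.univ.image e)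
        (Finset.Ico L (R - 1) \ S)) ∅ * G S =
      ∑ b ∈ interlacing e, G (Finset.univ.image b) := by
  classical
  symm
  rw [← Finset.sum_filter_of_ne (p := fun S => RowOK (Finset.Ico L R \ Finset.univ.image e)
        (Finset.Ico L (R - 1) \ S))]
  · refine Finset.sum_bij (fun b _ => Finset.univ.image b) (fun b h => ?_) (fun b h b' h' hbb => ?_)
      (fun S hS => ?_) (fun b h => ?_)
    · have : Finset.univ.image b ⊆ X := by
        intro x hx
        obtain ⟨i, -, rfl⟩ := Finset.mem_image.1 hx
        exact hb b h i
      rw [Finset.mem_filter, Finset.mem_powerset, rowOK_iff he hL hR (this.trans hX)]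
      exact ⟨this, b, h, rfl⟩
    · refine (StrictMono.range_inj (strictMono_of_mem_interlacing he h)
        (strictMono_of_mem_interlacing he h')).1 ?_
      simpa using congrArg (fun S : Finset ℤ => (S : Set ℤ)) hbb
    · rw [Finset.mem_filter, Finset.mem_powerset] at hS
      obtain ⟨b, h1, h2⟩ := (rowOK_iff he hL hR (hS.1.trans hX)).1 hS.2
      exact ⟨b, h1, h2⟩
    · have : Finset.univ.image b ⊆ X := by
        intro x hx
        obtain ⟨i, -, rfl⟩ := Finset.mem_image.1 hx
        exact hb b h i
      rw [Mtil_rowReg_of_rowOK, one_mul]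
      exact (rowOK_iff he hL hR (this.trans hX)).2 ⟨b, h, rfl⟩
  · intro S _ h
    by_contra hn
    exact h (by rw [Mtil_rowReg_eq_zero j fun h => hn h.1, zero_mul])

theorem sum_Ico_int_sub (F : ℤ → ℤ) {a b : ℤ} (h : a ≤ b) :
    ∑ x ∈ Finset.Ico a b, (F (x + 1) - F x) = F b - F a := by
  induction b, h using Int.leInduction with
  | base => simp
  | succ n hn ih =>
    have : Finset.Ico a (n + 1) = insert n (Finset.Ico a n) := by
      ext x
      simp only [Finset.mem_Ico, Finset.mem_insert]
      omega
    rw [this, Finset.sum_insert (by simp), ih]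
    ring

theorem det_cons_one {k : ℕ} (v : Fin (k + 1) → Fin k → ℤ) :
    (Matrix.of fun j => (Fin.cons 1 (v j) : Fin (k + 1) → ℤ)).det =
      (Matrix.of fun j i => v (Fin.succ j) i - v (Fin.castSucc j) i).det := by
  rw [Matrix.det_eq_of_forall_row_eq_smul_add_pred (fun _ : Fin k => (1 : ℤ))
    (B := Matrix.of fun j => (Fin.cons (Fin.cons 1 (v 0))
      (fun j : Fin k => Fin.cons 0 fun i => v j.succ i - v j.castSucc i) :
        Fin (k + 1) → Fin (k + 1) → ℤ) j)]
  · rw [Matrix.det_succ_column_zero, Fin.sum_univ_succ]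
    simp only [Matrix.of_apply, Fin.cons_zero, Fin.cons_succ, mul_zero, zero_mul,
      Finset.sum_const_zero, add_zero, Fin.val_zero, pow_zero, one_mul]
    congr 1
  · intro j
    simp
  · intro i j
    induction j using Fin.cases with
    | zero => simp
    | succ j => simp

theorem sum_interlacing_det {k : ℕ} {e : Fin (k + 1) → ℤ} (he : StrictMono e)
    (f F : Fin k → ℤ → ℤ) (hF : ∀ i x, F i (x + 1) = f i x + F i x) :
    ∑ b ∈ interlacing e, (Matrix.of fun j i => f i (b j)).det =
      (Matrix.of fun j => (Fin.cons 1 (fun i => F i (e j)) : Fin (k + 1) → ℤ)).det := by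
  have hf : ∀ i x, f i x = F i (x + 1) - F i x := fun i x => by rw [hF]; ring
  rw [det_cons_one fun j i => F i (e j)]
  have h := (Matrix.detRowAlternating (R := ℤ) (n := Fin k)).toMultilinearMap.map_sum_finset
    (fun j x i => f i x) (fun j => Finset.Ico (e j.castSucc) (e j.succ))
  refine (show _ = _ from h.symm).trans ?_
  change Matrix.det _ = Matrix.det _
  congr 1
  ext j i
  rw [Finset.sum_apply]
  simp only [hf, Matrix.of_apply]
  rw [sum_Ico_int_sub _ (he (Fin.castSucc_lt_succ (i := j))).le]

/-- The path matrix for an even number of rows above. -/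
def evenMat {k : ℕ} (s : ℤ) (a : Fin k → ℤ) : Matrix (Fin k) (Fin k) ℤ :=
  Matrix.of fun j i => Ring.choose (a j + s + i) (2 * i)

/-- The path matrix for an odd number of rows above. -/
def oddMat {k : ℕ} (s : ℤ) (a : Fin k → ℤ) : Matrix (Fin k) (Fin k) ℤ :=
  Matrix.of fun j i => Ring.choose (a j + s + 1 + i) (2 * i + 1)

theorem sum_interlacing_oddMat {k : ℕ} {e : Fin (k + 1) → ℤ} (he : StrictMono e) (s : ℤ) :
    ∑ b ∈ interlacing e, (oddMat s b).det = (evenMat s e).det := by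
  have := sum_interlacing_det he (fun i x => Ring.choose (x + s + 1 + (i : ℕ)) (2 * (i : ℕ) + 1))
    (fun i x => Ring.choose (x + s + ((i : ℕ) + 1)) (2 * (i : ℕ) + 1 + 1)) fun i x => by
      rw [show x + 1 + s + ((i : ℕ) + 1) = (x + s + ((i : ℕ) + 1)) + 1 by ring,
        Ring.choose_succ_succ]
      congr 2
      ring
  refine (this.trans ?_)
  congr 1
  ext j i
  induction i using Fin.cases with
  | zero => simp [evenMat]
  | succ i =>
    simp only [Matrix.of_apply, Fin.cons_succ, evenMat, Fin.val_succ]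
    push_cast
    rfl

theorem sum_interlacing_evenMat {k : ℕ} {a : Fin k → ℤ} {s : ℤ}
    (he : StrictMono (Fin.cons (-s - 1) a : Fin (k + 1) → ℤ)) :
    ∑ b ∈ interlacing (Fin.cons (-s - 1) a : Fin (k + 1) → ℤ), (evenMat (s + 1) b).det =
      (oddMat s a).det := by
  have := sum_interlacing_det he (fun i x => Ring.choose (x + (s + 1) + (i : ℕ)) (2 * (i : ℕ)))
    (fun i x => Ring.choose (x + s + 1 + (i : ℕ)) (2 * (i : ℕ) + 1)) fun i x => by
      rw [show x + 1 + s + 1 + (i : ℕ) = (x + s + 1 + (i : ℕ)) + 1 by ring,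
        Ring.choose_succ_succ]
      congr 2
      ring
  refine (this.trans ?_)
  rw [Matrix.det_succ_row_zero, Fin.sum_univ_succ, Finset.sum_eq_zero]
  · simp [oddMat]
    congr 1
  · intro i _
    have : Ring.choose (-s - 1 + s + 1 + ((i : ℕ) : ℤ)) (2 * (i : ℕ) + 1) = 0 := by
      rw [show -s - 1 + s + 1 + ((i : ℕ) : ℤ) = ((i : ℕ) : ℤ) by ring, Ring.choose_natCast,
        Nat.choose_eq_zero_of_lt (by omega), Nat.cast_zero]
    simp only [Matrix.of_apply, Fin.cons_succ, Fin.cons_zero, this]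
    simp

theorem factorial_smul_choose (x : ℤ) (i : ℕ) :
    ((2 * i).factorial : ℤ) * Ring.choose (x + i) (2 * i) =
      ∏ l ∈ Finset.range i, (x * (x + 1) - l * (l + 1)) := by
  have h : ((2 * i).factorial : ℤ) * Ring.choose (x + i) (2 * i) =
      ∏ l ∈ Finset.range (2 * i), (x + i - l) := by
    rw [← descPochhammer_eval_eq_prod_range, Polynomial.eval_eq_smeval,
      Ring.descPochhammer_eq_factorial_smul_choose, nsmul_eq_mul]
  rw [h]
  clear h
  induction i with
  | zero => simp
  | succ i ih =>
    rw [Finset.prod_range_succ _ i, ← ih, show 2 * (i + 1) = 2 * i + 1 + 1 by ring,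
      Finset.prod_range_succ, Finset.prod_range_succ']
    push_cast
    have : ∀ l : ℕ, x + ((i : ℤ) + 1) - ((l : ℤ) + 1) = x + i - l := fun l => by ring
    simp only [this]
    ring

theorem H2_even (k : ℕ) : H2 (2 * k) = ∏ i ∈ Finset.range k, (2 * i).factorial := by
  rw [H2]
  symm
  refine Finset.prod_bij (fun i _ => 2 * i) (fun i hi => ?_) (fun i _ j _ h => ?_)
    (fun j hj => ?_) fun i _ => rfl
  · simp only [Finset.mem_filter, Finset.mem_range] at hi ⊢
    omega
  · omega
  · simp only [Finset.mem_filter, Finset.mem_range] at hj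
    exact ⟨j / 2, by rw [Finset.mem_range]; omega, by omega⟩

theorem det_evenMat_zero {k : ℕ} (a : Fin k → ℤ) :
    (evenMat 0 a).det * H2 (2 * k) =
      ∏ i : Fin k, ∏ j ∈ Finset.Ioi i, (a j * (a j + 1) - a i * (a i + 1)) := by
  have h1 := Matrix.det_mul_row (fun i : Fin k => (((2 * (i : ℕ)).factorial : ℕ) : ℤ)) (evenMat 0 a)
  rw [H2_even, Finset.prod_range, mul_comm]
  push_cast
  rw [← h1, ← Matrix.det_vandermonde fun i => a i * (a i + 1)]
  symm
  let p : Fin k → Polynomial ℤ := fun i =>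
    ∏ l ∈ Finset.range i, (Polynomial.X - Polynomial.C ((l : ℤ) * (l + 1)))
  have hp : ∀ i, (p i).Monic := fun i =>
    Polynomial.monic_prod_of_monic _ _ fun l _ => Polynomial.monic_X_sub_C _
  have hd : ∀ i, (p i).natDegree = i := fun i => by
    rw [Polynomial.natDegree_prod_of_monic _ _ fun l _ => Polynomial.monic_X_sub_C _]
    simp only [Polynomial.natDegree_X_sub_C, Finset.sum_const, Finset.card_range, smul_eq_mul,
      mul_one]
  rw [Matrix.det_eval_matrixOfPolynomials_eq_det_vandermonde _ p hd hp]
  congr 1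
  ext j i
  simp only [Matrix.of_apply, evenMat, p, Polynomial.eval_prod, Polynomial.eval_sub,
    Polynomial.eval_X, Polynomial.eval_C, add_zero]
  rw [factorial_smul_choose]

/-- The up-pointing triangles in row `j` of a quartered hexagon with base `W`. -/
noncomputable def rowUp (W : ℤ) (j : ℕ) : Finset ℤ := Finset.Ico (-((j / 2 : ℕ) : ℤ)) (W - j)

/-- The down-pointing triangles in row `j` of a quartered hexagon with base `W`. -/
noncomputable def rowDn (W : ℤ) (j : ℕ) : Finset ℤ := Finset.Ico (-(((j + 1) / 2 : ℕ) : ℤ)) (W - j - 1)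

/-- Rows `lo, …, hi - 1` of a quartered hexagon with base `W`. -/
noncomputable def rowsReg (W : ℤ) (lo hi : ℕ) : Finset Tri :=
  (Finset.Ico lo hi).biUnion fun j => rowReg j (rowUp W j) (rowDn W j)

/-- The up-pointing triangles at the positions `A` in row `j`. -/
def upsAt (j : ℕ) (A : Finset ℤ) : Finset Tri := A.image fun x => upT x j

theorem rowUp_succ (W : ℤ) (j : ℕ) : rowUp W (j + 1) = rowDn W j := by
  rw [rowUp, rowDn]
  push_cast
  rw [sub_add_eq_sub_sub]

theorem up_mem_rowsReg {W : ℤ} {lo hi : ℕ} {p : ℤ × ℤ} :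
    (true, p) ∈ rowsReg W lo hi ↔ ∃ j : ℕ, lo ≤ j ∧ j < hi ∧ p.1 ∈ rowUp W j ∧ p.2 = j := by
  simp only [rowsReg, Finset.mem_biUnion, Finset.mem_Ico, mem_rowReg.1, and_assoc]

theorem dn_mem_rowsReg {W : ℤ} {lo hi : ℕ} {p : ℤ × ℤ} :
    (false, p) ∈ rowsReg W lo hi ↔ ∃ j : ℕ, lo ≤ j ∧ j < hi ∧ p.1 ∈ rowDn W j ∧ p.2 = j := by
  simp only [rowsReg, Finset.mem_biUnion, Finset.mem_Ico, mem_rowReg.2, and_assoc]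

theorem rowsReg_eq_union (W : ℤ) {lo hi : ℕ} (h : lo < hi) :
    rowsReg W lo hi = rowsReg W (lo + 1) hi ∪ rowReg lo (rowUp W lo) (rowDn W lo) := by
  have : Finset.Ico lo hi = insert lo (Finset.Ico (lo + 1) hi) := by
    ext j
    simp only [Finset.mem_Ico, Finset.mem_insert]
    omega
  rw [rowsReg, this, Finset.biUnion_insert, Finset.union_comm, rowsReg]

theorem le_of_mem_rowsReg {W : ℤ} {lo hi : ℕ} {t : Tri} (h : t ∈ rowsReg W lo hi) :
    (lo : ℤ) ≤ t.2.2 := by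
  obtain ⟨s, p⟩ := t
  cases s
  · obtain ⟨j, h1, -, -, h2⟩ := dn_mem_rowsReg.1 h
    dsimp only
    omega
  · obtain ⟨j, h1, -, -, h2⟩ := up_mem_rowsReg.1 h
    dsimp only
    omega

theorem mem_upsAt {j : ℕ} {A : Finset ℤ} {t : Tri} :
    t ∈ upsAt j A ↔ t.1 = true ∧ t.2.1 ∈ A ∧ t.2.2 = j := by
  obtain ⟨s, a, b⟩ := t
  simp only [upsAt, Finset.mem_image, upT, Prod.mk.injEq]
  constructor
  · rintro ⟨x, hx, rfl, rfl, rfl⟩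
    exact ⟨rfl, hx, rfl⟩
  · rintro ⟨rfl, h, rfl⟩
    exact ⟨a, h, rfl, rfl, rfl⟩

theorem Mtil_rowsReg_split (W : ℤ) {lo hi : ℕ} (h : lo < hi) (A : Finset ℤ) :
    Mtil (rowsReg W lo hi \ upsAt lo A) ∅ =
      ∑ S ∈ (if lo + 1 < hi then rowDn W lo else ∅).powerset,
        Mtil (rowReg lo (rowUp W lo \ A) (rowDn W lo \ S)) ∅ *
          Mtil (rowsReg W (lo + 1) hi \ upsAt (lo + 1) S) ∅ := by
  have hR : rowsReg W lo hi \ upsAt lo A =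
      rowsReg W (lo + 1) hi ∪ rowReg lo (rowUp W lo \ A) (rowDn W lo) := by
    rw [rowsReg_eq_union W h, Finset.union_sdiff_distrib, Finset.sdiff_eq_self_of_disjoint]
    · congr 1
      ext ⟨s, a, b⟩
      cases s <;> simp only [Finset.mem_sdiff, mem_rowReg.1, mem_rowReg.2, mem_upsAt] <;> grind
    · rw [Finset.disjoint_left]
      intro t ht ht'
      have := le_of_mem_rowsReg ht
      have := (mem_upsAt.1 ht').2.2
      omega
  rw [hR, Mtil_union ((lo : ℤ) + 1) _ _ _ (if lo + 1 < hi then rowDn W lo else ∅)]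
  · refine Finset.sum_congr rfl fun S hS => ?_
    rw [mul_comm]
    congr 2
    ext ⟨s, a, b⟩
    cases s <;> simp only [Finset.mem_sdiff, mem_rowReg.1, mem_rowReg.2, Finset.mem_image, dnT,
      Prod.mk.injEq] <;> grind
  · intro t ht
    have := le_of_mem_rowsReg ht
    omega
  · rintro ⟨s, a, b⟩ ht
    have : b = lo := by
      cases s
      · exact (mem_rowReg.2 (a, b)|>.1 ht).2
      · exact (mem_rowReg.1 (a, b)|>.1 ht).2
    dsimp only
    omega
  · simp
  · intro x
    rw [upT, dnT, up_mem_rowsReg, mem_rowReg.2]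
    constructor
    · intro hx
      split_ifs at hx with hl
      · refine ⟨⟨lo + 1, le_rfl, hl, ?_, ?_⟩, ⟨hx, ?_⟩, by simp⟩
        · rw [rowUp_succ]
          exact hx
        · push_cast
          rfl
        · simp
      · simp at hx
    · rintro ⟨⟨j, h1, h2, -, h3⟩, ⟨h4, -⟩, -⟩
      rw [if_pos (by omega)]
      exact h4

theorem Mtil_rowsReg_empty (W : ℤ) (lo : ℕ) : Mtil (rowsReg W lo lo \ upsAt lo ∅) ∅ = 1 := by
  simp [rowsReg, upsAt, Mtil_empty]

theorem Mtil_rowsReg_odd_of_even {k r : ℕ} {W : ℤ}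
    (ih : ∀ b : Fin (k + 1) → ℤ, StrictMono b →
      (∀ j, -((r + 1 : ℕ) : ℤ) ≤ b j ∧ b j < W - 2 * (r + 1 : ℕ)) →
      (Mtil (rowsReg W (2 * (r + 1)) (2 * (r + 1) + 2 * k + 1) \
        upsAt (2 * (r + 1)) (Finset.univ.image b)) ∅ : ℤ) = (evenMat (r + 1 : ℕ) b).det)
    {a : Fin (k + 1) → ℤ} (ha : StrictMono a)
    (hr : ∀ j, -(r : ℤ) ≤ a j ∧ a j < W - 2 * r - 1) :
    (Mtil (rowsReg W (2 * r + 1) (2 * r + 1 + 2 * (k + 1)) \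
        upsAt (2 * r + 1) (Finset.univ.image a)) ∅ : ℤ) = (oddMat r a).det := by
  have he : StrictMono (Fin.cons (-(r : ℤ) - 1) a : Fin (k + 2) → ℤ) := by
    rw [Fin.strictMono_iff_lt_succ]
    intro i
    induction i using Fin.cases with
    | zero =>
      have := (hr 0).1
      simp only [Fin.castSucc_zero, Fin.cons_zero, Fin.cons_succ]
      omega
    | succ i =>
      rw [← Fin.succ_castSucc, Fin.cons_succ, Fin.cons_succ]
      exact ha Fin.castSucc_lt_succ
  have hL : ∀ i, -(r : ℤ) - 1 ≤ (Fin.cons (-(r : ℤ) - 1) a : Fin (k + 2) → ℤ) i := fun i => by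
    induction i using Fin.cases with
    | zero => simp
    | succ i =>
      have := (hr i).1
      rw [Fin.cons_succ]
      omega
  have hR : ∀ i, (Fin.cons (-(r : ℤ) - 1) a : Fin (k + 2) → ℤ) i < W - 2 * r - 1 := fun i => by
    induction i using Fin.cases with
    | zero =>
      have := hr 0
      rw [Fin.cons_zero]
      omega
    | succ i =>
      have := (hr i).2
      rw [Fin.cons_succ]
      omega
  have hdn : rowDn W (2 * r + 1) = Finset.Ico (-(r : ℤ) - 1) (W - 2 * r - 1 - 1) := by
    rw [rowDn, show (2 * r + 1 + 1) / 2 = r + 1 by omega]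
    push_cast
    congr 1 <;> ring
  have hup : rowUp W (2 * r + 1) \ Finset.univ.image a =
      Finset.Ico (-(r : ℤ) - 1) (W - 2 * r - 1) \
        Finset.univ.image (Fin.cons (-(r : ℤ) - 1) a : Fin (k + 2) → ℤ) := by
    rw [rowUp, show (2 * r + 1) / 2 = r by omega]
    ext x
    simp only [Finset.mem_sdiff, Finset.mem_Ico, Finset.mem_image, Finset.mem_univ, true_and,
      Fin.exists_fin_succ, Fin.cons_zero, Fin.cons_succ]
    push_cast
    have : x = -(r : ℤ) - 1 ∨ x ≠ -(r : ℤ) - 1 := em _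
    grind
  have hb : ∀ b ∈ interlacing (Fin.cons (-(r : ℤ) - 1) a : Fin (k + 2) → ℤ), ∀ i,
      -(r : ℤ) - 1 ≤ b i ∧ b i < W - 2 * r - 1 - 1 := fun b hb i => by
    have h1 := mem_interlacing.1 hb i
    have h2 := hL i.castSucc
    have h3 := hR i.succ
    omega
  rw [Mtil_rowsReg_split W (by omega), if_pos (by omega), hup, hdn,
    sum_Mtil_rowReg he _ hL hR subset_rfl fun b h i => Finset.mem_Ico.2 (hb b h i)]
  rw [← sum_interlacing_evenMat he]
  push_cast
  refine Finset.sum_congr rfl fun b h => ?_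
  rw [← Nat.cast_succ, ← ih b (strictMono_of_mem_interlacing he h) fun j => ?_]
  · congr 3
    congr 1
    omega
  · have := hb b h j
    push_cast
    omega

theorem Mtil_rowsReg_even_of_odd {k r : ℕ} {W : ℤ}
    (ih : ∀ b : Fin k → ℤ, StrictMono b → (∀ j, -(r : ℤ) ≤ b j ∧ b j < W - 2 * r - 1) →
      (Mtil (rowsReg W (2 * r + 1) (2 * r + 1 + 2 * k) \
        upsAt (2 * r + 1) (Finset.univ.image b)) ∅ : ℤ) = (oddMat r b).det)
    {a : Fin (k + 1) → ℤ} (ha : StrictMono a)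
    (hr : ∀ j, -(r : ℤ) ≤ a j ∧ a j < W - 2 * r) :
    (Mtil (rowsReg W (2 * r) (2 * r + 2 * k + 1) \
        upsAt (2 * r) (Finset.univ.image a)) ∅ : ℤ) = (evenMat r a).det := by
  have hdn : rowDn W (2 * r) = Finset.Ico (-(r : ℤ)) (W - 2 * r - 1) := by
    rw [rowDn, show (2 * r + 1) / 2 = r by omega]
    push_cast
    rfl
  have hup : rowUp W (2 * r) = Finset.Ico (-(r : ℤ)) (W - 2 * r) := by
    rw [rowUp, show (2 * r) / 2 = r by omega]
    push_cast
    rfl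
  have hb : ∀ b ∈ interlacing a, ∀ i, -(r : ℤ) ≤ b i ∧ b i < W - 2 * r - 1 := fun b hb i => by
    have h1 := mem_interlacing.1 hb i
    have h2 := hr i.castSucc
    have h3 := hr i.succ
    omega
  rw [Mtil_rowsReg_split W (by omega), hup, hdn,
    sum_Mtil_rowReg ha _ (fun i => (hr i).1) (fun i => (hr i).2)]
  · rw [← sum_interlacing_oddMat ha]
    push_cast
    refine Finset.sum_congr rfl fun b h => ?_
    rw [← ih b (strictMono_of_mem_interlacing ha h) (hb b h)]
    congr 3
    congr 1
    omega
  · split_ifs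
    · rfl
    · simp
  · intro b h i
    rw [if_pos (by have := i.2; omega)]
    exact Finset.mem_Ico.2 (hb b h i)

theorem Mtil_rowsReg_even (W : ℤ) (k : ℕ) : ∀ (r : ℕ) (a : Fin (k + 1) → ℤ), StrictMono a →
    (∀ j, -(r : ℤ) ≤ a j ∧ a j < W - 2 * r) →
    (Mtil (rowsReg W (2 * r) (2 * r + 2 * k + 1) \
        upsAt (2 * r) (Finset.univ.image a)) ∅ : ℤ) = (evenMat r a).det := by
  induction k with
  | zero =>
    intro r a ha hr
    refine Mtil_rowsReg_even_of_odd (fun b _ _ => ?_) ha hr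
    simp [Mtil_rowsReg_empty]
  | succ k ih =>
    intro r a ha hr
    exact Mtil_rowsReg_even_of_odd
      (fun b hb hbr => Mtil_rowsReg_odd_of_even (ih (r + 1)) hb hbr) ha hr

theorem card_rowUp (W : ℤ) (j : ℕ) : (rowUp W j).card = (W - j + (j / 2 : ℕ)).toNat := by
  rw [rowUp, Int.card_Ico]
  congr 1
  ring

theorem card_rowDn (W : ℤ) (j : ℕ) :
    (rowDn W j).card = (W - j - 1 + ((j + 1) / 2 : ℕ)).toNat := by
  rw [rowDn, Int.card_Ico]
  congr 1
  ring

theorem Mtil_rowsReg_eq_zero_of_succ {W : ℤ} {lo hi c c' : ℕ} (h : lo < hi)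
    (ih : ∀ S ⊆ (if lo + 1 < hi then rowDn W lo else ∅), S.card ≠ c' →
      Mtil (rowsReg W (lo + 1) hi \ upsAt (lo + 1) S) ∅ = 0)
    (hc : (rowUp W lo).card + c' = (rowDn W lo).card + c) {A : Finset ℤ}
    (hA : A ⊆ rowUp W lo) (hAc : A.card ≠ c) :
    Mtil (rowsReg W lo hi \ upsAt lo A) ∅ = 0 := by
  rw [Mtil_rowsReg_split W h]
  refine Finset.sum_eq_zero fun S hS => ?_
  rw [Finset.mem_powerset] at hS
  by_cases hSc : S.card = c'
  · rw [Mtil_rowReg_eq_zero, zero_mul]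
    rintro ⟨-, hcard⟩
    have hS' : S ⊆ rowDn W lo := by
      split_ifs at hS
      · exact hS
      · exact hS.trans (Finset.empty_subset _)
    rw [Finset.card_sdiff_of_subset hA, Finset.card_sdiff_of_subset hS'] at hcard
    have := Finset.card_le_card hA
    have := Finset.card_le_card hS'
    omega
  · rw [ih S hS hSc, mul_zero]

theorem Mtil_rowsReg_even_eq_zero (W : ℤ) (k : ℕ) : ∀ (r : ℕ) (A : Finset ℤ), (r : ℤ) + k + 1 ≤ W →
    A ⊆ rowUp W (2 * r) → A.card ≠ k + 1 →
    Mtil (rowsReg W (2 * r) (2 * r + 2 * k + 1) \ upsAt (2 * r) A) ∅ = 0 := by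
  induction k with
  | zero =>
    intro r A hW hA hAc
    refine Mtil_rowsReg_eq_zero_of_succ (c' := 0) (by omega) (fun S hS hSc => ?_) ?_ hA hAc
    · rw [if_neg (by omega), Finset.subset_empty] at hS
      simp [hS] at hSc
    · rw [card_rowUp, card_rowDn]
      omega
  | succ k ih =>
    intro r A hW hA hAc
    refine Mtil_rowsReg_eq_zero_of_succ (c' := k + 1) (by omega) (fun S hS hSc => ?_) ?_ hA hAc
    · rw [if_pos (by omega), ← rowUp_succ] at hS
      refine Mtil_rowsReg_eq_zero_of_succ (c' := k + 1) (by omega) (fun S hS hSc => ?_) ?_ hS hSc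
      · rw [if_pos (by omega), ← rowUp_succ] at hS
        have := ih (r + 1) S (by push_cast at *; omega) hS hSc
        rw [show 2 * (r + 1) + 2 * k + 1 = 2 * r + 2 * (k + 1) + 1 by ring] at this
        exact this
      · rw [card_rowUp, card_rowDn]
        omega
    · rw [card_rowUp, card_rowDn]
      omega

theorem prod_filter_lt_eq_prod_Ioi {k : ℕ} {S : Finset ℕ} {e : Fin k → ℕ}
    (he : StrictMono e) (hS : Finset.univ.image e = S) (g : ℕ → ℕ → ℚ) :
    ∏ p ∈ S, ∏ q ∈ S.filter (fun q => p < q), g p q =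
      ∏ i : Fin k, ∏ j ∈ Finset.Ioi i, g (e i) (e j) := by
  rw [← hS, Finset.prod_image fun i _ j _ h => he.injective h]
  refine Finset.prod_congr rfl fun i _ => ?_
  rw [Finset.filter_image, Finset.prod_image fun i _ j _ h => he.injective h]
  refine Finset.prod_congr ?_ fun _ _ => rfl
  ext j
  simp [he.lt_iff_lt]

/-- The abscissas of the positions in `A`. -/
def abscissas (A : Finset ℕ) : Finset ℤ := A.image fun i : ℕ => (i : ℤ) - 1

theorem mem_abscissas {A : Finset ℕ} {x : ℤ} : x ∈ abscissas A ↔ ∃ i ∈ A, (i : ℤ) - 1 = x := by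
  simp [abscissas]

theorem card_abscissas (A : Finset ℕ) : (abscissas A).card = A.card :=
  Finset.card_image_of_injective _ fun i j h => by omega

theorem abscissas_subset {A : Finset ℕ} {W : ℕ} (hA : A ⊆ Finset.Icc 1 W) :
    abscissas A ⊆ rowUp W 0 := by
  intro x hx
  obtain ⟨i, hi, rfl⟩ := mem_abscissas.1 hx
  have := Finset.mem_Icc.1 (hA hi)
  simp only [rowUp, Finset.mem_Ico]
  omega

theorem Lreg_eq (m n : ℕ) (A : Finset ℕ) :
    Lreg m n A = rowsReg ((n + (m + 1) / 2 : ℕ) : ℤ) 0 m \ upsAt 0 (abscissas A) := by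
  rw [Lreg]
  congr 1
  · rw [rowsReg, Finset.range_eq_Ico]
    refine Finset.biUnion_congr rfl fun j _ => ?_
    rw [rowReg, rowUp, rowDn]
    congr 1
    · ext ⟨s, a, b⟩
      simp only [Finset.mem_image, Finset.mem_range, upT, Finset.mem_Ico, Prod.mk.injEq]
      constructor
      · rintro ⟨c, hc, rfl, rfl, rfl⟩
        exact ⟨_, by omega, rfl, rfl, rfl⟩
      · rintro ⟨c, hc, rfl, rfl, rfl⟩
        exact ⟨(c + (j / 2 : ℕ)).toNat, by omega, rfl, by omega, rfl⟩
    · ext ⟨s, a, b⟩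
      simp only [Finset.mem_image, Finset.mem_range, dnT, Finset.mem_Ico, Prod.mk.injEq]
      constructor
      · rintro ⟨c, hc, rfl, rfl, rfl⟩
        exact ⟨_, by omega, rfl, rfl, rfl⟩
      · rintro ⟨c, hc, rfl, rfl, rfl⟩
        exact ⟨(c + ((j + 1) / 2 : ℕ)).toNat, by omega, rfl, by omega, rfl⟩
  · rw [upDents, upsAt, abscissas, Finset.image_image]
    rfl

theorem Lreg_odd_eq {k : ℕ} (hk : 0 < k) (n : ℕ) (A : Finset ℕ) :
    Lreg (2 * k - 1) n A =
      rowsReg ((n + k : ℕ) : ℤ) (2 * 0) (2 * 0 + 2 * (k - 1) + 1) \ upsAt (2 * 0) (abscissas A) := by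
  rw [Lreg_eq, show n + (2 * k - 1 + 1) / 2 = n + k by omega,
    show 2 * k - 1 = 2 * 0 + 2 * (k - 1) + 1 by omega]

theorem Mtil_Lreg_eq_zero {k n : ℕ} (hk : 0 < k) {A : Finset ℕ} (hA : A ⊆ Finset.Icc 1 (n + k))
    (hAc : A.card ≠ k) : Mtil (Lreg (2 * k - 1) n A) ∅ = 0 := by
  rw [Lreg_odd_eq hk]
  refine Mtil_rowsReg_even_eq_zero _ _ _ _ ?_ (abscissas_subset hA) ?_
  · push_cast
    omega
  · rw [card_abscissas]
    omega

theorem Mtil_Lreg_mul_H2 {k n : ℕ} {A : Finset ℕ} (hA : A ⊆ Finset.Icc 1 (n + k))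
    (hAc : A.card = k) : (Mtil (Lreg (2 * k - 1) n A) ∅ : ℚ) * H2 (2 * k) = prodDS1 A := by
  obtain rfl | ⟨k, rfl⟩ : k = 0 ∨ ∃ l, k = l + 1 := by
    cases k
    · exact Or.inl rfl
    · exact Or.inr ⟨_, rfl⟩
  · rw [Finset.card_eq_zero] at hAc
    subst hAc
    have : Lreg (2 * 0 - 1) n ∅ = ∅ := by simp [Lreg]
    rw [this, Mtil_empty, H2_even]
    simp [prodDS1]
  · have hs := (A.orderEmbOfFin hAc).strictMono
    have hi : Finset.univ.image (A.orderEmbOfFin hAc) = A := by simp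
    have hmem : ∀ j, A.orderEmbOfFin hAc j ∈ Finset.Icc 1 (n + (k + 1)) := fun j =>
      hA (A.orderEmbOfFin_mem hAc j)
    have ha : abscissas A = Finset.univ.image fun j => (A.orderEmbOfFin hAc j : ℤ) - 1 := by
      conv_lhs => rw [← hi]
      rw [abscissas, Finset.image_image]
      rfl
    have h := Mtil_rowsReg_even ((n + (k + 1) : ℕ) : ℤ) k 0
      (fun j => (A.orderEmbOfFin hAc j : ℤ) - 1)
      (fun i j hij => by
        have := hs hij
        dsimp only
        omega)
      (fun j => by
        have := Finset.mem_Icc.1 (hmem j)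
        omega)
    have h2 := det_evenMat_zero fun j => (A.orderEmbOfFin hAc j : ℤ) - 1
    rw [Lreg_odd_eq k.succ_pos, ha, prodDS1, prod_filter_lt_eq_prod_Ioi hs hi]
    rw [Nat.cast_zero] at h
    rw [← h] at h2
    have h3 := congrArg (Int.cast : ℤ → ℚ) h2
    push_cast at h3 ⊢
    convert h3 using 1
    refine Finset.prod_congr rfl fun i _ => Finset.prod_congr rfl fun j _ => ?_
    ring

/-- The contribution of the pair `s, a` to `prodDS1`, irrespective of the order. -/
def pairDS1 (s a : ℕ) : ℚ := |(s : ℚ) * (s - 1) - a * (a - 1)|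

theorem pairDS1_comm (s a : ℕ) : pairDS1 s a = pairDS1 a s := abs_sub_comm _ _

theorem pairDS1_of_lt {s a : ℕ} (h : s < a) :
    pairDS1 s a = ((a : ℚ) - s) * ((a : ℚ) + s - 1) := by
  have h' : (s : ℚ) + 1 ≤ a := by exact_mod_cast h
  have hs : (0 : ℚ) ≤ s := s.cast_nonneg
  rw [pairDS1, abs_sub_comm, abs_of_nonneg]
  · ring
  · have := mul_nonneg (a := (a : ℚ) - s) (b := (a : ℚ) + s - 1) (by linarith) (by linarith)
    linarith

theorem pairDS1_pos {s a : ℕ} (hs : 1 ≤ s) (ha : 1 ≤ a) (h : s ≠ a) : 0 < pairDS1 s a := by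
  have key : ∀ {s a : ℕ}, 1 ≤ s → s < a → 0 < pairDS1 s a := fun {s a} hs h => by
    rw [pairDS1_of_lt h]
    have h' : (s : ℚ) + 1 ≤ a := by exact_mod_cast h
    have hs : (1 : ℚ) ≤ s := by exact_mod_cast hs
    exact mul_pos (by linarith) (by linarith)
  obtain h | h := h.lt_or_gt
  · exact key hs h
  · rw [pairDS1_comm]
    exact key ha h

theorem prodDS1_eq (S : Finset ℕ) :
    prodDS1 S = ∏ p ∈ S, ∏ q ∈ S.filter (fun q => p < q), pairDS1 p q :=
  Finset.prod_congr rfl fun _ _ => Finset.prod_congr rfl fun _ hq =>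
    (pairDS1_of_lt (Finset.mem_filter.1 hq).2).symm

theorem prodDS1_insert {s : ℕ} {A : Finset ℕ} (hs : s ∉ A) :
    prodDS1 (insert s A) = prodDS1 A * ∏ a ∈ A, pairDS1 s a := by
  simp only [prodDS1_eq, Finset.prod_filter]
  rw [Finset.prod_insert hs, Finset.prod_insert hs, if_neg (lt_irrefl s), one_mul,
    Finset.prod_congr rfl fun p (hp : p ∈ A) => Finset.prod_insert hs, Finset.prod_mul_distrib,
    ← mul_assoc, ← Finset.prod_mul_distrib, mul_comm]
  congr 1
  refine Finset.prod_congr rfl fun a ha => ?_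
  obtain h | h := (ne_of_mem_of_not_mem ha hs).lt_or_gt
  · rw [if_neg h.not_gt, if_pos h, one_mul, pairDS1_comm]
  · rw [if_neg h.not_gt, if_pos h, mul_one]

theorem prodDS1_union {A S : Finset ℕ} (h : Disjoint A S) :
    prodDS1 (A ∪ S) = prodDS1 A * prodDS1 S * ∏ s ∈ S, ∏ a ∈ A, pairDS1 s a := by
  induction S using Finset.induction_on with
  | empty => simp [prodDS1]
  | insert s S hs ih =>
    rw [Finset.disjoint_insert_right] at h
    rw [Finset.union_insert, prodDS1_insert (by simp [h.1, hs]), ih h.2, prodDS1_insert hs,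
      Finset.prod_insert hs, Finset.prod_union h.2]
    ring

theorem prodDS1_pos {S : Finset ℕ} (h : ∀ s ∈ S, 1 ≤ s) : 0 < prodDS1 S := by
  rw [prodDS1_eq]
  refine Finset.prod_pos fun p hp => Finset.prod_pos fun q hq => ?_
  rw [Finset.mem_filter] at hq
  exact pairDS1_pos (h p hp) (h q hq.1) hq.2.ne

theorem H2_pos (n : ℕ) : 0 < H2 n :=
  Finset.prod_pos fun j _ => j.factorial_pos

theorem mem_abscissas_iff {A : Finset ℕ} {x : ℤ} :
    x ∈ abscissas A ↔ 0 ≤ x + 1 ∧ (x + 1).toNat ∈ A := by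
  rw [mem_abscissas]
  constructor
  · rintro ⟨i, hi, rfl⟩
    exact ⟨by omega, by simpa using hi⟩
  · rintro ⟨h, hx⟩
    exact ⟨_, hx, by omega⟩

theorem upT_mem_Lreg {m n : ℕ} {A : Finset ℕ} {x : ℤ} :
    upT x 0 ∈ Lreg m n A ↔
      0 < m ∧ 0 ≤ x ∧ x < (n + (m + 1) / 2 : ℕ) ∧ x ∉ abscissas A := by
  rw [Lreg_eq, upT, Finset.mem_sdiff, up_mem_rowsReg, mem_upsAt]
  dsimp only
  constructor
  · rintro ⟨⟨j, -, h1, h2, h3⟩, h4⟩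
    obtain rfl : j = 0 := by omega
    simp only [rowUp, Finset.mem_Ico] at h2
    refine ⟨h1, by omega, by omega, fun h => h4 ⟨rfl, h, rfl⟩⟩
  · rintro ⟨h1, h2, h3, h4⟩
    refine ⟨⟨0, le_rfl, h1, ?_, rfl⟩, fun h => h4 h.2.1⟩
    simp only [rowUp, Finset.mem_Ico]
    omega

theorem Lreg_sdiff (m n : ℕ) (A S : Finset ℕ) :
    Lreg m n A \ (abscissas S).image (fun x => upT x 0) = Lreg m n (A ∪ S) := by
  rw [Lreg_eq, Lreg_eq, sdiff_sdiff_left, abscissas, abscissas, abscissas, Finset.image_union,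
    upsAt, upsAt, Finset.image_union]
  rfl

theorem height_of_mem_Lreg {m n : ℕ} {A : Finset ℕ} {t : Tri} (h : t ∈ Lreg m n A) :
    0 ≤ t.2.2 := by
  rw [Lreg_eq] at h
  have := le_of_mem_rowsReg (Finset.mem_sdiff.1 h).1
  simpa using this

theorem Mtil_Fbar_eq_sum {x y n : ℕ} {U D B : Finset ℕ} (hu : U.card ≤ n) (hd : D.card ≤ n) :
    Mtil (Fbar x y n U D) (barrierLoz B) =
      ∑ S ∈ (if 0 < y + U.card ∧ 0 < y + D.card then
          Finset.Icc 1 (x + y + n) \ (U ∪ D ∪ B) else ∅).powerset,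
        Mtil (Lreg (2 * (y + U.card) - 1) (x + n - U.card) (U ∪ S)) ∅ *
          Mtil (Lreg (2 * (y + D.card) - 1) (x + n - D.card) (D ∪ S)) ∅ := by
  rw [Fbar, Mtil_union 0 _ _ _ (abscissas (if 0 < y + U.card ∧ 0 < y + D.card then
          Finset.Icc 1 (x + y + n) \ (U ∪ D ∪ B) else ∅))]
  · rw [abscissas, Finset.powerset_image, Finset.sum_image]
    · refine Finset.sum_congr rfl fun S _ => ?_
      have h1 := Lreg_sdiff (2 * y + 2 * U.card - 1) (x + n - U.card) U S
      have h2 := Lreg_sdiff (2 * y + 2 * D.card - 1) (x + n - D.card) D S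
      rw [abscissas] at h1 h2
      have h3 : (S.image fun i : ℕ => (i : ℤ) - 1).image (fun x => dnT x (0 - 1)) =
          ((S.image fun i : ℕ => (i : ℤ) - 1).image fun x => upT x 0).image reflTri := by
        rw [Finset.image_image (f := fun x => upT x 0)]
        congr 1
        ext1 a
        simp [reflTri, upT, dnT]
      rw [h1, mul_add, mul_add, ← mul_add 2 y D.card, h3,
        ← Finset.image_sdiff _ _ reflTri_involutive.injective, Mtil_image_refl, mul_add, h2]
    · intro S _ T _ h
      exact Finset.image_injective (fun i j h => by omega) h
  · exact fun t ht => height_of_mem_Lreg ht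
  · intro t ht
    obtain ⟨t, h, rfl⟩ := Finset.mem_image.1 ht
    have : 0 ≤ t.2.2 := height_of_mem_Lreg h
    rw [reflTri]
    split_ifs <;> dsimp only <;> omega
  · intro l hl
    obtain ⟨i, -, rfl⟩ := Finset.mem_image.1 hl
    exact ⟨rfl, rfl⟩
  · intro a
    have h1 : dnT a (0 - 1) ∈ (Lreg (2 * y + 2 * D.card - 1) (x + n - D.card) D).image reflTri ↔
        upT a 0 ∈ Lreg (2 * y + 2 * D.card - 1) (x + n - D.card) D := by
      have : dnT a (0 - 1) = reflTri (upT a 0) := by simp [reflTri, upT, dnT]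
      rw [this, Function.Injective.mem_finset_image reflTri_involutive.injective]
    have h2 : vertLoz 0 a ∈ barrierLoz B ↔ a ∈ abscissas B := by
      simp only [vertLoz, barrierLoz, mem_abscissas, Finset.mem_image, Prod.mk.injEq]
      grind
    rw [h1, h2, upT_mem_Lreg, upT_mem_Lreg]
    by_cases h : 0 < y + U.card ∧ 0 < y + D.card
    · rw [if_pos h, show x + n - U.card + (2 * y + 2 * U.card - 1 + 1) / 2 = x + y + n by omega,
        show x + n - D.card + (2 * y + 2 * D.card - 1 + 1) / 2 = x + y + n by omega]
      simp only [mem_abscissas_iff, Finset.mem_sdiff, Finset.mem_Icc, Finset.mem_union]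
      have c1 : 0 < 2 * y + 2 * U.card - 1 := by omega
      have c2 : 0 < 2 * y + 2 * D.card - 1 := by omega
      by_cases ha : 0 ≤ a
      · have c3 : 0 ≤ a + 1 := by omega
        have c4 : 1 ≤ (a + 1).toNat := by omega
        have c5 : a < (x + y + n : ℕ) ↔ (a + 1).toNat ≤ x + y + n := by omega
        simp only [c1, c2, c3, c4, c5, ha, true_and, not_or]
        tauto
      · constructor
        · intro h'
          omega
        · intro h'
          omega
    · rw [if_neg h]
      simp only [abscissas, Finset.image_empty, Finset.notMem_empty, false_iff]
      rintro ⟨⟨h3, -⟩, ⟨h4, -⟩, -⟩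
      omega

theorem Mtil_Fbar {x y n : ℕ} {U D B : Finset ℕ} (hu : U.card ≤ n) (hd : D.card ≤ n)
    (hU : U ⊆ Finset.Icc 1 (x + y + n)) (hD : D ⊆ Finset.Icc 1 (x + y + n)) :
    (Mtil (Fbar x y n U D) (barrierLoz B) : ℚ) =
      prodDS1 U / H2 (2 * U.card + 2 * y) * (prodDS1 D / H2 (2 * D.card + 2 * y)) *
        ∑ S ∈ (Finset.Icc 1 (x + y + n) \ (U ∪ D ∪ B)).powersetCard y,
          prodDS1 S ^ 2 * ∏ s ∈ S, ((∏ a ∈ U ∪ D, pairDS1 s a) * ∏ a ∈ U ∩ D, pairDS1 s a) := by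
  set Y := Finset.Icc 1 (x + y + n) \ (U ∪ D ∪ B) with hY
  have hsub : ∀ S ⊆ Y, S ⊆ Finset.Icc 1 (x + y + n) ∧ Disjoint U S ∧ Disjoint D S := fun S hS => by
    refine ⟨hS.trans Finset.sdiff_subset, ?_, ?_⟩
    · rw [Finset.disjoint_right]
      intro a ha haU
      have := Finset.mem_sdiff.1 (hS ha)
      simp [haU] at this
    · rw [Finset.disjoint_right]
      intro a ha haD
      have := Finset.mem_sdiff.1 (hS ha)
      simp [haD] at this
  set Z := if 0 < y + U.card ∧ 0 < y + D.card then Y else ∅ with hZ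
  have hZY : Z ⊆ Y := by
    rw [hZ]
    split_ifs
    · rfl
    · simp
  have hpc : Y.powersetCard y = Z.powersetCard y := by
    rw [hZ]
    split_ifs with h
    · rfl
    · obtain rfl : y = 0 := by omega
      simp
  rw [Mtil_Fbar_eq_sum hu hd, ← hY, ← hZ, hpc, Finset.mul_sum, ← Finset.sum_subset
    (show Z.powersetCard y ⊆ Z.powerset from fun S hS =>
      Finset.mem_powerset.2 (Finset.mem_powersetCard.1 hS).1)]
  · push_cast
    refine Finset.sum_congr rfl fun S hS => ?_
    obtain ⟨hSZ, hSc⟩ := Finset.mem_powersetCard.1 hS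
    obtain ⟨h1, h2, h3⟩ := hsub S (hSZ.trans hZY)
    have e1 := Mtil_Lreg_mul_H2 (k := y + U.card) (n := x + n - U.card) (A := U ∪ S)
      (by rw [show x + n - U.card + (y + U.card) = x + y + n by omega]
          exact Finset.union_subset hU h1)
      (by rw [Finset.card_union_of_disjoint h2, hSc, add_comm])
    have e2 := Mtil_Lreg_mul_H2 (k := y + D.card) (n := x + n - D.card) (A := D ∪ S)
      (by rw [show x + n - D.card + (y + D.card) = x + y + n by omega]
          exact Finset.union_subset hD h1)
      (by rw [Finset.card_union_of_disjoint h3, hSc, add_comm])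
    rw [prodDS1_union h2] at e1
    rw [prodDS1_union h3] at e2
    have p1 : (H2 (2 * (y + U.card)) : ℚ) ≠ 0 := by exact_mod_cast (H2_pos _).ne'
    have p2 : (H2 (2 * (y + D.card)) : ℚ) ≠ 0 := by exact_mod_cast (H2_pos _).ne'
    rw [eq_div_of_mul_eq p1 e1, eq_div_of_mul_eq p2 e2,
      show 2 * U.card + 2 * y = 2 * (y + U.card) by ring,
      show 2 * D.card + 2 * y = 2 * (y + D.card) by ring,
      Finset.prod_congr rfl fun s _ => Finset.prod_union_inter (s₁ := U) (s₂ := D)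
        (f := pairDS1 s), Finset.prod_mul_distrib]
    ring
  · intro S hS hSc
    rw [Finset.mem_powersetCard, ← Finset.mem_powerset, not_and] at hSc
    have hSc := hSc hS
    rw [Finset.mem_powerset] at hS
    have hpos : 0 < y + U.card := by
      by_contra h
      rw [hZ, if_neg (by omega), Finset.subset_empty] at hS
      rw [hS, Finset.card_empty] at hSc
      omega
    obtain ⟨h1, h2, -⟩ := hsub S (hS.trans hZY)
    rw [Mtil_Lreg_eq_zero hpos, zero_mul]
    · rw [show x + n - U.card + (y + U.card) = x + y + n by omega]
      exact Finset.union_subset hU h1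
    · rw [Finset.card_union_of_disjoint h2]
      omega

/-- **Shuffling Theorem for halved hexagons, `F̄`-type** (Theorem 3.1, (3.2)). -/
theorem shuffling_halved_hexagons_Fbar
    (x y u d u' d' n : ℕ) (hu : u ≤ n) (hd : d ≤ n) (hu' : u' ≤ n) (hd' : d' ≤ n)
    (U D U' D' B : Finset ℕ)
    (hUc : U.card = u) (hDc : D.card = d) (hU'c : U'.card = u') (hD'c : D'.card = d')
    (hUsub : U ⊆ Finset.Icc 1 (x + y + n)) (hDsub : D ⊆ Finset.Icc 1 (x + y + n))
    (hU'sub : U' ⊆ Finset.Icc 1 (x + y + n)) (hD'sub : D' ⊆ Finset.Icc 1 (x + y + n))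
    (hn : (U ∪ D).card = n)
    (hcup : U ∪ D = U' ∪ D') (hcap : U ∩ D = U' ∩ D')
    (hBsub : B ⊆ Finset.Icc 1 (x + y + n) \ (U ∪ D)) (hBc : B.card ≤ x) :
    (Mtil (Fbar x y n U D) (barrierLoz B) : ℚ) /
      (Mtil (Fbar x y n U' D') (barrierLoz B) : ℚ) =
    prodDS1 U / prodDS1 U' * (prodDS1 D / prodDS1 D') *
      (((H2 (2 * u' + 2 * y) : ℚ) * (H2 (2 * d' + 2 * y) : ℚ)) /
        ((H2 (2 * u + 2 * y) : ℚ) * (H2 (2 * d + 2 * y) : ℚ))) := by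
  subst hUc hDc hU'c hD'c
  rw [Mtil_Fbar hu hd hUsub hDsub, Mtil_Fbar hu' hd' hU'sub hD'sub, ← hcup, ← hcap]
  set K : ℚ := ∑ S ∈ (Finset.Icc 1 (x + y + n) \ (U ∪ D ∪ B)).powersetCard y,
    prodDS1 S ^ 2 * ∏ s ∈ S, ((∏ a ∈ U ∪ D, pairDS1 s a) * ∏ a ∈ U ∩ D, pairDS1 s a) with hK
  have one_le : ∀ A ⊆ Finset.Icc 1 (x + y + n), ∀ a ∈ A, 1 ≤ a := fun A hA a ha =>
    (Finset.mem_Icc.1 (hA ha)).1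
  have hKpos : 0 < K := by
    refine Finset.sum_pos (fun S hS => ?_) (Finset.powersetCard_nonempty.2 ?_)
    · have hS := (Finset.mem_powersetCard.1 hS).1
      have hS1 := one_le S (hS.trans Finset.sdiff_subset)
      have hpair : ∀ s ∈ S, ∀ a ∈ U ∪ D, 0 < pairDS1 s a := fun s hs a ha => by
        refine pairDS1_pos (hS1 s hs) (one_le _ (Finset.union_subset hUsub hDsub) a ha) ?_
        rintro rfl
        exact (Finset.mem_sdiff.1 (hS hs)).2 (Finset.mem_union_left _ ha)
      refine mul_pos (pow_pos (prodDS1_pos hS1) 2) (Finset.prod_pos fun s hs => mul_pos ?_ ?_)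
      · exact Finset.prod_pos fun a ha => hpair s hs a ha
      · exact Finset.prod_pos fun a ha => hpair s hs a
          (Finset.mem_union_left _ (Finset.mem_inter.1 ha).1)
    · have h1 := Finset.le_card_sdiff (U ∪ D ∪ B) (Finset.Icc 1 (x + y + n))
      have h2 := Finset.card_union_le (U ∪ D) B
      rw [Nat.card_Icc] at h1
      omega
  have hH : ∀ m, (H2 m : ℚ) ≠ 0 := fun m => by exact_mod_cast (H2_pos m).ne'
  have h1 := (prodDS1_pos (one_le _ hU'sub)).ne'
  have h2 := (prodDS1_pos (one_le _ hD'sub)).ne'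
  have h3 := hH (2 * U.card + 2 * y)
  have h4 := hH (2 * D.card + 2 * y)
  have h5 := hH (2 * U'.card + 2 * y)
  have h6 := hH (2 * D'.card + 2 * y)
  rw [mul_div_mul_right _ _ hKpos.ne']
  field_simp
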